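/- Let X be the middle-thirds Cantor set, s = log 2 / log 3, and μ the normalized s-Hausdorff measure on X. Let α₀ be the μ-almost sure value of the average density A(x) (which exists), let α_min = inf_{x∈X} A̲(x), and let f(α) = dim_H {x ∈ X : A(x) exists and equals α}. Then (1/α₀)^{1/s} < 1.06126 ≤ (sup_α f(α)/(sα))^{1/s} ≤ (1/α_min)^{1/s} ≤ 1.37546, where the supremum is over α > 0. -/

import Mathlib

open MeasureTheory Metric Filter Set
open scoped ENNReal Topology

noncomputable section

/-- The average `(1/(-log t)) ∫_t^1 μ(B(x,ρ)) ρ^{-s-1} dρ`. -/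
def avgA (μ : Measure ℝ) (s x t : ℝ) : ℝ :=
  (1 / (-Real.log t)) * ∫ ρ in t..1, (μ (ball x ρ)).toReal * ρ ^ (-s - 1)

/-- The upper average density of `μ` at `x`. -/
def upperAvg (μ : Measure ℝ) (s x : ℝ) : ℝ := limsup (fun t => avgA μ s x t) (𝓝[>] 0)

/-- The lower average density of `μ` at `x`. -/
def lowerAvg (μ : Measure ℝ) (s x : ℝ) : ℝ := liminf (fun t => avgA μ s x t) (𝓝[>] 0)

/-- The two branches of the Cantor iterated function system, the left one reversing orientation. -/
def foldMap (b : Bool) (x : ℝ) : ℝ := bif b then (2 + x) / 3 else (1 - x) / 3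

@[simp] lemma foldMap_true (x : ℝ) : foldMap true x = (2 + x) / 3 := rfl

@[simp] lemma foldMap_false (x : ℝ) : foldMap false x = (1 - x) / 3 := rfl

lemma continuous_foldMap (b : Bool) : Continuous (foldMap b) := by
  cases b
  · exact (continuous_const.sub continuous_id).div_const 3
  · exact (continuous_const.add continuous_id).div_const 3

lemma measurable_foldMap (b : Bool) : Measurable (foldMap b) := (continuous_foldMap b).measurable

/-- `ν` is the self-similar measure of `foldMap` with weights `p` (right) and `1 - p` (left). -/
structure FoldInvariant (p : ℝ) (ν : Measure ℝ) : Prop where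
  isProb : IsProbabilityMeasure ν
  nonneg : 0 ≤ p
  le_one : p ≤ 1
  supp : ∀ᵐ x ∂ν, x ∈ Icc (0 : ℝ) 1
  eq : ν = ENNReal.ofReal p • ν.map (foldMap true) + ENNReal.ofReal (1 - p) • ν.map (foldMap false)

namespace FoldInvariant

variable {p : ℝ} {ν : Measure ℝ}

lemma integrable (h : FoldInvariant p ν) {f : ℝ → ℝ} (hf : Measurable f) {C : ℝ}
    (hC : ∀ x ∈ Icc (0 : ℝ) 1, |f x| ≤ C) : Integrable f ν := by
  have := h.isProb
  exact Integrable.of_bound hf.aestronglyMeasurable C (h.supp.mono fun x hx => hC x hx)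

lemma integral_eq (h : FoldInvariant p ν) {f : ℝ → ℝ} (hf : Measurable f) {C : ℝ}
    (hC : ∀ x ∈ Icc (0 : ℝ) 1, |f x| ≤ C) :
    ∫ x, f x ∂ν = p * ∫ x, f (foldMap true x) ∂ν + (1 - p) * ∫ x, f (foldMap false x) ∂ν := by
  have hi := h.integrable hf hC
  rw [h.eq] at hi
  conv_lhs => rw [h.eq]
  rw [integral_add_measure hi.left_of_add_measure hi.right_of_add_measure, integral_smul_measure,
    integral_smul_measure, integral_map (measurable_foldMap true).aemeasurable
    hf.aestronglyMeasurable, integral_map (measurable_foldMap false).aemeasurable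
    hf.aestronglyMeasurable, ENNReal.toReal_ofReal h.nonneg,
    ENNReal.toReal_ofReal (by linarith [h.le_one]), smul_eq_mul, smul_eq_mul]

lemma integrable_id (h : FoldInvariant p ν) : Integrable (fun x => x) ν :=
  h.integrable measurable_id (C := 1) fun x hx => abs_le.2 ⟨by linarith [hx.1], hx.2⟩

lemma mean (h : FoldInvariant p ν) : ∫ x, x ∂ν = (1 + p) / (4 - 2 * p) := by
  have := h.isProb
  have e := h.integral_eq (f := fun x => x) measurable_id (C := 1)
    fun x hx => abs_le.2 ⟨by linarith [hx.1], hx.2⟩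
  simp only [foldMap_true, foldMap_false, integral_div] at e
  rw [integral_add (integrable_const _) h.integrable_id,
    integral_sub (integrable_const _) h.integrable_id] at e
  simp only [integral_const, probReal_univ, smul_eq_mul, one_mul] at e
  rw [eq_div_iff (by linarith [h.le_one])]
  linarith

lemma integral_le_of_affine (h : FoldInvariant p ν) {f : ℝ → ℝ} (hf : Measurable f) {C : ℝ}
    (hC : ∀ x ∈ Icc (0 : ℝ) 1, |f x| ≤ C) {a b : ℝ}
    (hab : ∀ x ∈ Icc (0 : ℝ) 1, f x ≤ a * (1 - x) + b * x) :
    ∫ x, f x ∂ν ≤ a * (1 - (1 + p) / (4 - 2 * p)) + b * ((1 + p) / (4 - 2 * p)) := by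
  have := h.isProb
  have i1 : Integrable (fun x => a * (1 - x)) ν :=
    ((integrable_const 1).sub h.integrable_id).const_mul a
  have i2 : Integrable (fun x => b * x) ν := h.integrable_id.const_mul b
  calc ∫ x, f x ∂ν ≤ ∫ x, (a * (1 - x) + b * x) ∂ν :=
        integral_mono_ae (h.integrable hf hC) (i1.add i2) (h.supp.mono hab)
    _ = _ := by
        rw [integral_add i1 i2, integral_const_mul, integral_const_mul,
          integral_sub (integrable_const _) h.integrable_id, h.mean]
        simp

end FoldInvariant

/-- The average of `(c + y) ^ (-s)` over the measure `μ`. -/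
def rieszAvg (μ : Measure ℝ) (s c : ℝ) : ℝ := ∫ y, (c + y) ^ (-s) ∂μ

lemma convexOn_rpow_neg {s : ℝ} (hs : 0 ≤ s) : ConvexOn ℝ (Ioi 0) fun x : ℝ => x ^ (-s) := by
  have h1 : ConvexOn ℝ (Ioi 0) fun x : ℝ => -s * Real.log x := by
    have := (strictConcaveOn_log_Ioi.concaveOn.neg).smul hs
    refine this.congr fun x _ => ?_
    simp
  have h2 : ConvexOn ℝ (Ioi 0) fun x : ℝ => Real.exp (-s * Real.log x) := by
    refine ⟨convex_Ioi 0, fun x hx y hy a b ha hb hab => ?_⟩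
    refine (Real.exp_le_exp.2 (h1.2 hx hy ha hb hab)).trans ?_
    exact convexOn_exp.2 (mem_univ _) (mem_univ _) ha hb hab
  refine h2.congr fun x hx => ?_
  rw [Real.rpow_def_of_pos hx]
  ring_nf

lemma rpow_neg_le_one {s x : ℝ} (hs : 0 ≤ s) (hx : 1 ≤ x) : x ^ (-s) ≤ 1 :=
  Real.rpow_le_one_of_one_le_of_nonpos hx (by linarith)

section RieszAvg

variable {μ : Measure ℝ} {s c : ℝ}

lemma measurable_add_rpow (c s : ℝ) : Measurable fun y : ℝ => (c + y) ^ (-s) :=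
  (measurable_const.add measurable_id).pow_const _

lemma measurable_rieszAvg [SFinite μ] (s : ℝ) : Measurable (rieszAvg μ s) := by
  refine StronglyMeasurable.measurable (StronglyMeasurable.integral_prod_right ?_)
  exact ((measurable_fst.add measurable_snd).pow_const _).stronglyMeasurable

lemma abs_add_rpow_le (hs : 0 ≤ s) (hc : 0 < c) :
    ∀ y ∈ Icc (0 : ℝ) 1, |(c + y) ^ (-s)| ≤ c ^ (-s) := fun y hy => by
  rw [abs_of_nonneg (Real.rpow_nonneg (by linarith [hy.1]) _)]
  exact Real.rpow_le_rpow_of_nonpos hc (by linarith [hy.1]) (by linarith)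

lemma integrable_add_rpow {p : ℝ} (h : FoldInvariant p μ) (hs : 0 ≤ s) (hc : 0 < c) :
    Integrable (fun y => (c + y) ^ (-s)) μ :=
  h.integrable (measurable_add_rpow c s) (abs_add_rpow_le hs hc)

lemma rieszAvg_nonneg {p : ℝ} (h : FoldInvariant p μ) (hc : 0 < c) : 0 ≤ rieszAvg μ s c :=
  integral_nonneg_of_ae (h.supp.mono fun y hy => Real.rpow_nonneg (by linarith [hy.1]) _)

lemma rieszAvg_anti {p : ℝ} (h : FoldInvariant p μ) (hs : 0 ≤ s) (hc : 0 < c) {d : ℝ}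
    (hcd : c ≤ d) : rieszAvg μ s d ≤ rieszAvg μ s c :=
  integral_mono_ae (integrable_add_rpow h hs (hc.trans_le hcd)) (integrable_add_rpow h hs hc)
    (h.supp.mono fun y hy =>
      Real.rpow_le_rpow_of_nonpos (by linarith [hy.1]) (by linarith) (by linarith))

lemma rieszAvg_le_rpow {p : ℝ} (h : FoldInvariant p μ) (hs : 0 ≤ s) (hc : 0 < c) :
    rieszAvg μ s c ≤ c ^ (-s) := by
  have := h.isProb
  calc rieszAvg μ s c ≤ ∫ _, c ^ (-s) ∂μ :=
        integral_mono_ae (integrable_add_rpow h hs hc) (integrable_const _)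
          (h.supp.mono fun y hy => (le_abs_self _).trans (abs_add_rpow_le hs hc y hy))
    _ = _ := by simp

lemma abs_rieszAvg_le {p : ℝ} (h : FoldInvariant p μ) (hs : 0 ≤ s) (hc : 1 ≤ c) :
    |rieszAvg μ s c| ≤ 1 := by
  rw [abs_of_nonneg (rieszAvg_nonneg h (by linarith))]
  exact (rieszAvg_le_rpow h hs (by linarith)).trans (rpow_neg_le_one hs hc)

lemma rpow_le_rieszAvg (h : FoldInvariant (1 / 2) μ) (hs : 0 ≤ s) (hc : 0 < c) :
    (c + 1 / 2) ^ (-s) ≤ rieszAvg μ s c := by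
  have := h.isProb
  have hsub : Icc c (c + 1) ⊆ Ioi 0 := fun x hx => hc.trans_le hx.1
  have key := ((convexOn_rpow_neg hs).subset hsub (convex_Icc _ _)).map_integral_le (μ := μ)
    (f := fun y => c + y) ?_ isClosed_Icc
    (h.supp.mono fun y hy => ⟨by linarith [hy.1], by linarith [hy.2]⟩)
    ((integrable_const c).add h.integrable_id) (integrable_add_rpow h hs hc)
  · have e : ∫ y, (c + y) ∂μ = c + 1 / 2 := by
      rw [integral_add (integrable_const c) h.integrable_id, h.mean]
      norm_num
    rwa [e] at key
  · exact fun x hx => (Real.continuousAt_rpow_const x (-s) (Or.inl (hsub hx).ne')).continuousWithinAt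

lemma rieszAvg_le_chord (h : FoldInvariant (1 / 2) μ) (hs : 0 ≤ s) (hc : 0 < c) :
    rieszAvg μ s c ≤ (c ^ (-s) + (c + 1) ^ (-s)) / 2 := by
  have := h.integral_le_of_affine (measurable_add_rpow c s) (abs_add_rpow_le hs hc)
    (a := c ^ (-s)) (b := (c + 1) ^ (-s)) fun x hx => by
      have hc1 : c + 1 ∈ Ioi (0 : ℝ) := by simp only [mem_Ioi]; linarith
      have hx1 : 0 ≤ 1 - x := by linarith [hx.2]
      have := (convexOn_rpow_neg hs).2 (mem_Ioi.2 hc) hc1 hx1 hx.1 (by ring)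
      simp only [smul_eq_mul] at this
      calc (c + x) ^ (-s) = ((1 - x) * c + x * (c + 1)) ^ (-s) := by ring_nf
        _ ≤ _ := by linarith
  unfold rieszAvg
  norm_num at this ⊢
  linarith

lemma convexOn_rieszAvg {p : ℝ} (h : FoldInvariant p μ) (hs : 0 ≤ s) :
    ConvexOn ℝ (Ioi 0) (rieszAvg μ s) := by
  refine ⟨convex_Ioi 0, fun x hx y hy a b ha hb hab => ?_⟩
  have hx' : 0 < x := hx
  have hy' : 0 < y := hy
  have hxy : 0 < a • x + b • y := (convex_Ioi (0 : ℝ)) hx hy ha hb hab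
  simp only [smul_eq_mul, rieszAvg] at hxy ⊢
  rw [← integral_const_mul, ← integral_const_mul,
    ← integral_add ((integrable_add_rpow h hs hx').const_mul a)
      ((integrable_add_rpow h hs hy').const_mul b)]
  refine integral_mono_ae (integrable_add_rpow h hs hxy)
    (((integrable_add_rpow h hs hx').const_mul a).add
      ((integrable_add_rpow h hs hy').const_mul b)) (h.supp.mono fun t ht => ?_)
  have := (convexOn_rpow_neg hs).2 (x := x + t) (y := y + t) (by simp; linarith [ht.1])
    (by simp; linarith [ht.1]) ha hb hab
  simp only [smul_eq_mul] at this ⊢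
  calc (a * x + b * y + t) ^ (-s) = (a * (x + t) + b * (y + t)) ^ (-s) := by
        congr 1; linear_combination (-t) * hab
    _ ≤ _ := this

end RieszAvg

section Recursion

variable {μ ν : Measure ℝ} {s c p : ℝ}

lemma three_rpow (hs : s = Real.log 2 / Real.log 3) : (3 : ℝ) ^ s = 2 := by
  have h3 : Real.log 3 ≠ 0 := (Real.log_pos (by norm_num)).ne'
  rw [Real.rpow_def_of_pos (by norm_num), hs, mul_div_cancel₀ _ h3, Real.exp_log (by norm_num)]

lemma cantorDim_pos (hs : s = Real.log 2 / Real.log 3) : 0 < s := by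
  rw [hs]; exact div_pos (Real.log_pos (by norm_num)) (Real.log_pos (by norm_num))

lemma div_three_rpow_neg (hs : s = Real.log 2 / Real.log 3) {x : ℝ} (hx : 0 ≤ x) :
    (x / 3) ^ (-s) = 2 * x ^ (-s) := by
  rw [Real.div_rpow hx (by norm_num), Real.rpow_neg (by norm_num : (0 : ℝ) ≤ 3), three_rpow hs]
  field_simp

lemma integral_one_sub (hr : μ.map (fun x => 1 - x) = μ) {f : ℝ → ℝ} (hf : Measurable f) :
    ∫ x, f (1 - x) ∂μ = ∫ x, f x ∂μ := by
  conv_rhs => rw [← hr]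
  rw [integral_map (by fun_prop) hf.aestronglyMeasurable]

lemma rieszAvg_eq_add (hs : s = Real.log 2 / Real.log 3) (h : FoldInvariant (1 / 2) μ)
    (hr : μ.map (fun x => 1 - x) = μ) (hc : 0 < c) :
    rieszAvg μ s c = rieszAvg μ s (3 * c) + rieszAvg μ s (3 * c + 2) := by
  have hs0 := (cantorDim_pos hs).le
  unfold rieszAvg
  rw [h.integral_eq (measurable_add_rpow c s) (abs_add_rpow_le hs0 hc)]
  have e1 : ∫ y, (c + foldMap true y) ^ (-s) ∂μ = 2 * ∫ y, (3 * c + 2 + y) ^ (-s) ∂μ := by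
    rw [← integral_const_mul]
    refine integral_congr_ae (h.supp.mono fun y hy => ?_)
    dsimp only
    rw [← div_three_rpow_neg hs (by linarith [hy.1]), foldMap_true]
    ring_nf
  have e2 : ∫ y, (c + foldMap false y) ^ (-s) ∂μ = 2 * ∫ y, (3 * c + y) ^ (-s) ∂μ := by
    rw [← integral_one_sub hr (measurable_add_rpow (3 * c) s), ← integral_const_mul]
    refine integral_congr_ae (h.supp.mono fun y hy => ?_)
    dsimp only
    rw [← div_three_rpow_neg hs (by linarith [hy.2]), foldMap_false]
    ring_nf
  rw [e1, e2]
  ring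

lemma measurable_rieszAvg_add [SFinite μ] (c s : ℝ) : Measurable fun x => rieszAvg μ s (c + x) :=
  (measurable_rieszAvg s).comp (measurable_const.add measurable_id)

lemma measurable_rieszAvg_sub [SFinite μ] (c s : ℝ) : Measurable fun x => rieszAvg μ s (c - x) :=
  (measurable_rieszAvg s).comp (measurable_const.sub measurable_id)

lemma abs_rieszAvg_add_le (h : FoldInvariant (1 / 2) μ) (hs : 0 ≤ s) (hc : 1 ≤ c) :
    ∀ x ∈ Icc (0 : ℝ) 1, |rieszAvg μ s (c + x)| ≤ 1 :=
  fun x hx => abs_rieszAvg_le h hs (by linarith [hx.1])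

lemma abs_rieszAvg_sub_le (h : FoldInvariant (1 / 2) μ) (hs : 0 ≤ s) (hc : 2 ≤ c) :
    ∀ x ∈ Icc (0 : ℝ) 1, |rieszAvg μ s (c - x)| ≤ 1 :=
  fun x hx => abs_rieszAvg_le h hs (by linarith [hx.2])

lemma integrable_rieszAvg_add (h : FoldInvariant (1 / 2) μ) (hν : FoldInvariant p ν) (hs : 0 ≤ s)
    (hc : 1 ≤ c) : Integrable (fun x => rieszAvg μ s (c + x)) ν := by
  have := h.isProb
  exact hν.integrable (measurable_rieszAvg_add c s) (abs_rieszAvg_add_le h hs hc)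

lemma integrable_rieszAvg_sub (h : FoldInvariant (1 / 2) μ) (hν : FoldInvariant p ν) (hs : 0 ≤ s)
    (hc : 2 ≤ c) : Integrable (fun x => rieszAvg μ s (c - x)) ν := by
  have := h.isProb
  exact hν.integrable (measurable_rieszAvg_sub c s) (abs_rieszAvg_sub_le h hs hc)

lemma integral_rieszAvg_add (hs : s = Real.log 2 / Real.log 3) (h : FoldInvariant (1 / 2) μ)
    (hr : μ.map (fun x => 1 - x) = μ) (hν : FoldInvariant p ν) (hc : 1 ≤ c) :
    ∫ x, rieszAvg μ s (c + x) ∂ν =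
      p * (∫ x, rieszAvg μ s (3 * c + 2 + x) ∂ν + ∫ x, rieszAvg μ s (3 * c + 4 + x) ∂ν) +
      (1 - p) * (∫ x, rieszAvg μ s (3 * c + 1 - x) ∂ν + ∫ x, rieszAvg μ s (3 * c + 3 - x) ∂ν) := by
  have := h.isProb
  have hs0 := (cantorDim_pos hs).le
  rw [hν.integral_eq (measurable_rieszAvg_add c s) (abs_rieszAvg_add_le h hs0 hc),
    ← integral_add (integrable_rieszAvg_add h hν hs0 (by linarith))
      (integrable_rieszAvg_add h hν hs0 (by linarith)),
    ← integral_add (integrable_rieszAvg_sub h hν hs0 (by linarith))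
      (integrable_rieszAvg_sub h hν hs0 (by linarith))]
  congr 2
  all_goals
    refine integral_congr_ae (hν.supp.mono fun x hx => ?_)
    dsimp only
    rw [rieszAvg_eq_add hs h hr (by
      simp only [foldMap_true, foldMap_false]
      linarith [hx.1, hx.2])]
    simp only [foldMap_true, foldMap_false]
    congr 2 <;> ring

lemma integral_rieszAvg_sub (hs : s = Real.log 2 / Real.log 3) (h : FoldInvariant (1 / 2) μ)
    (hr : μ.map (fun x => 1 - x) = μ) (hν : FoldInvariant p ν) (hc : 2 ≤ c) :
    ∫ x, rieszAvg μ s (c - x) ∂ν =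
      p * (∫ x, rieszAvg μ s (3 * c - 2 - x) ∂ν + ∫ x, rieszAvg μ s (3 * c - x) ∂ν) +
      (1 - p) * (∫ x, rieszAvg μ s (3 * c - 1 + x) ∂ν + ∫ x, rieszAvg μ s (3 * c + 1 + x) ∂ν) := by
  have := h.isProb
  have hs0 := (cantorDim_pos hs).le
  rw [hν.integral_eq (measurable_rieszAvg_sub c s) (abs_rieszAvg_sub_le h hs0 hc),
    ← integral_add (integrable_rieszAvg_sub h hν hs0 (by linarith))
      (integrable_rieszAvg_sub h hν hs0 (by linarith)),
    ← integral_add (integrable_rieszAvg_add h hν hs0 (by linarith))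
      (integrable_rieszAvg_add h hν hs0 (by linarith))]
  congr 2
  all_goals
    refine integral_congr_ae (hν.supp.mono fun x hx => ?_)
    dsimp only
    rw [rieszAvg_eq_add hs h hr (by
      simp only [foldMap_true, foldMap_false]
      linarith [hx.1, hx.2])]
    simp only [foldMap_true, foldMap_false]
    congr 2 <;> ring

lemma integral_rieszAvg_add_le (hs : 0 ≤ s) (h : FoldInvariant (1 / 2) μ)
    (hν : FoldInvariant p ν) (hc : 1 ≤ c) :
    ∫ x, rieszAvg μ s (c + x) ∂ν ≤
      (c ^ (-s) + (c + 1) ^ (-s)) / 2 * (1 - (1 + p) / (4 - 2 * p)) +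
      ((c + 1) ^ (-s) + (c + 2) ^ (-s)) / 2 * ((1 + p) / (4 - 2 * p)) := by
  have := h.isProb
  refine hν.integral_le_of_affine (measurable_rieszAvg_add c s) (abs_rieszAvg_add_le h hs hc)
    fun x hx => ?_
  have hx1 : 0 ≤ 1 - x := by linarith [hx.2]
  have hc0 : 0 < c := by linarith
  have hc1 : 0 < c + 1 := by linarith
  have key := (convexOn_rieszAvg h hs).2 (mem_Ioi.2 hc0) (mem_Ioi.2 hc1) hx1 hx.1 (by ring)
  have e : (1 - x) • c + x • (c + 1) = c + x := by simp only [smul_eq_mul]; ring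
  rw [e, smul_eq_mul, smul_eq_mul] at key
  have k0 := rieszAvg_le_chord h hs hc0
  have k1 := rieszAvg_le_chord h hs hc1
  have e2 : c + 1 + 1 = c + 2 := by ring
  rw [e2] at k1
  calc _ ≤ _ := key
    _ ≤ (1 - x) * ((c ^ (-s) + (c + 1) ^ (-s)) / 2) +
        x * (((c + 1) ^ (-s) + (c + 2) ^ (-s)) / 2) :=
      add_le_add (mul_le_mul_of_nonneg_left k0 hx1) (mul_le_mul_of_nonneg_left k1 hx.1)
    _ = _ := by ring

lemma integral_rieszAvg_sub_le (hs : 0 ≤ s) (h : FoldInvariant (1 / 2) μ)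
    (hν : FoldInvariant p ν) (hc : 2 ≤ c) :
    ∫ x, rieszAvg μ s (c - x) ∂ν ≤
      (c ^ (-s) + (c + 1) ^ (-s)) / 2 * (1 - (1 + p) / (4 - 2 * p)) +
      ((c - 1) ^ (-s) + c ^ (-s)) / 2 * ((1 + p) / (4 - 2 * p)) := by
  have := h.isProb
  refine hν.integral_le_of_affine (measurable_rieszAvg_sub c s) (abs_rieszAvg_sub_le h hs hc)
    fun x hx => ?_
  have hx1 : 0 ≤ 1 - x := by linarith [hx.2]
  have hc0 : 0 < c := by linarith
  have hc1 : 0 < c - 1 := by linarith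
  have key := (convexOn_rieszAvg h hs).2 (mem_Ioi.2 hc0) (mem_Ioi.2 hc1) hx1 hx.1 (by ring)
  have e : (1 - x) • c + x • (c - 1) = c - x := by simp only [smul_eq_mul]; ring
  rw [e, smul_eq_mul, smul_eq_mul] at key
  have k0 := rieszAvg_le_chord h hs hc0
  have k1 := rieszAvg_le_chord h hs hc1
  have e2 : c - 1 + 1 = c := by ring
  rw [e2] at k1
  calc _ ≤ _ := key
    _ ≤ (1 - x) * ((c ^ (-s) + (c + 1) ^ (-s)) / 2) +
        x * (((c - 1) ^ (-s) + c ^ (-s)) / 2) :=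
      add_le_add (mul_le_mul_of_nonneg_left k0 hx1) (mul_le_mul_of_nonneg_left k1 hx.1)
    _ = _ := by ring

lemma rpow_le_integral_rieszAvg_add (hs : 0 ≤ s) (h : FoldInvariant (1 / 2) μ) (hc : 1 ≤ c) :
    (c + 1) ^ (-s) ≤ ∫ x, rieszAvg μ s (c + x) ∂μ := by
  calc (c + 1) ^ (-s) = (c + 1 / 2 + 1 / 2) ^ (-s) := by ring_nf
    _ ≤ rieszAvg μ s (c + 1 / 2) := rpow_le_rieszAvg h hs (by linarith)
    _ ≤ _ := integral_mono_ae (integrable_add_rpow h hs (by linarith))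
      (integrable_rieszAvg_add h h hs hc) (h.supp.mono fun x hx => by
        dsimp only
        rw [add_right_comm]
        exact rpow_le_rieszAvg h hs (by linarith [hx.1]))

lemma integral_rieszAvg_add_self (hs : s = Real.log 2 / Real.log 3) (h : FoldInvariant (1 / 2) μ)
    (hr : μ.map (fun x => 1 - x) = μ) (hc : 1 ≤ c) :
    ∫ x, rieszAvg μ s (c + x) ∂μ =
      (∫ x, rieszAvg μ s (3 * c + x) ∂μ + 2 * ∫ x, rieszAvg μ s (3 * c + 2 + x) ∂μ +
        ∫ x, rieszAvg μ s (3 * c + 4 + x) ∂μ) / 2 := by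
  have := h.isProb
  rw [integral_rieszAvg_add hs h hr h hc, ← integral_one_sub hr (measurable_rieszAvg_sub _ s),
    ← integral_one_sub hr (measurable_rieszAvg_sub (3 * c + 3) s)]
  have e1 : ∀ x : ℝ, 3 * c + 1 - (1 - x) = 3 * c + x := fun x => by ring
  have e2 : ∀ x : ℝ, 3 * c + 3 - (1 - x) = 3 * c + 2 + x := fun x => by ring
  simp only [e1, e2]
  ring

end Recursion

section Numerics

variable {μ ν : Measure ℝ} {s c p : ℝ}

lemma rpow_neg_pow {x : ℝ} (hx : 0 ≤ x) (b : ℕ) :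
    (x ^ (-s)) ^ b = (x ^ b) ^ (-s) := by
  rw [← Real.rpow_mul_natCast hx, ← Real.rpow_natCast_mul hx, mul_comm]

lemma three_pow_rpow_neg (hs : s = Real.log 2 / Real.log 3) (a : ℕ) :
    (((3 : ℝ) ^ a) ^ (-s)) = ((2 : ℝ) ^ a)⁻¹ := by
  rw [← rpow_neg_pow (by norm_num), Real.rpow_neg (by norm_num), three_rpow hs, inv_pow]

lemma rpow_neg_le_of_pow_le (hs : s = Real.log 2 / Real.log 3) {x : ℝ} (a b : ℕ) (c : ℝ)
    (hx : 0 ≤ x) (hc : 0 ≤ c) (hb : b ≠ 0) (h1 : (3 : ℝ) ^ a ≤ x ^ b) (h2 : 1 ≤ 2 ^ a * c ^ b) :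
    x ^ (-s) ≤ c := by
  have hs0 := (cantorDim_pos hs).le
  refine le_of_pow_le_pow_left₀ hb hc ?_
  rw [rpow_neg_pow hx]
  refine (Real.rpow_le_rpow_of_nonpos (by positivity) h1 (by linarith)).trans ?_
  rw [three_pow_rpow_neg hs, inv_le_iff_one_le_mul₀ (by positivity), mul_comm]
  exact h2

lemma le_rpow_neg_of_pow_le (hs : s = Real.log 2 / Real.log 3) {x : ℝ} (a b : ℕ) (c : ℝ)
    (hx : 0 < x) (hb : b ≠ 0) (h1 : x ^ b ≤ (3 : ℝ) ^ a) (h2 : 2 ^ a * c ^ b ≤ 1) :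
    c ≤ x ^ (-s) := by
  have hs0 := (cantorDim_pos hs).le
  refine le_of_pow_le_pow_left₀ hb (Real.rpow_nonneg hx.le _) ?_
  rw [rpow_neg_pow hx.le]
  refine le_trans ?_ (Real.rpow_le_rpow_of_nonpos (by positivity) h1 (by linarith))
  rw [three_pow_rpow_neg hs, ← one_div, le_div_iff₀ (by positivity), mul_comm]
  exact h2

/-- The lower bound for `rieszAvg μ s c` from `n` subdivisions and Jensen's inequality. -/
def rieszLower (s : ℝ) : ℕ → ℝ → ℝ
  | 0, c => (c + 1 / 2) ^ (-s)
  | n + 1, c => rieszLower s n (3 * c) + rieszLower s n (3 * c + 2)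

lemma rieszLower_le (hs : s = Real.log 2 / Real.log 3) (h : FoldInvariant (1 / 2) μ)
    (hr : μ.map (fun x => 1 - x) = μ) (n : ℕ) :
    ∀ c, 0 < c → rieszLower s n c ≤ rieszAvg μ s c := by
  induction n with
  | zero => exact fun c hc => rpow_le_rieszAvg h (cantorDim_pos hs).le hc
  | succ n ih =>
    intro c hc
    rw [rieszAvg_eq_add hs h hr hc]
    exact add_le_add (ih _ (by linarith)) (ih _ (by linarith))

set_option exponentiation.threshold 50000 in
set_option maxRecDepth 10000 in
lemma log_two_le_rieszAvg_two (hs : s = Real.log 2 / Real.log 3) (h : FoldInvariant (1 / 2) μ)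
    (hr : μ.map (fun x => 1 - x) = μ) :
    (1.37546 : ℝ) ^ (-s) * Real.log 2 ≤ rieszAvg μ s 2 := by
  have hu : (1.37546 : ℝ) ^ (-s) ≤ 0.817803754 :=
    rpow_neg_le_of_pow_le hs 251 865 _ (by norm_num) (by norm_num) (by norm_num) (by norm_num)
      (by norm_num)
  have hl2 := Real.log_two_lt_d9
  have hl0 : 0 < Real.log 2 := Real.log_pos (by norm_num)
  refine le_trans ?_ (rieszLower_le hs h hr 5 2 (by norm_num))
  have t0 : (0.020166914 : ℝ) ≤ (973 / 2 : ℝ) ^ (-s) :=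
    le_rpow_neg_of_pow_le hs 13432 2385 _ (by norm_num) (by norm_num) (by norm_num) (by norm_num)
  have t1 : (0.020114778 : ℝ) ≤ (977 / 2 : ℝ) ^ (-s) :=
    le_rpow_neg_of_pow_le hs 6712 1191 _ (by norm_num) (by norm_num) (by norm_num) (by norm_num)
  have t2 : (0.020011550 : ℝ) ≤ (985 / 2 : ℝ) ^ (-s) :=
    le_rpow_neg_of_pow_le hs 4853 860 _ (by norm_num) (by norm_num) (by norm_num) (by norm_num)
  have t3 : (0.019960442 : ℝ) ≤ (989 / 2 : ℝ) ^ (-s) :=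
    le_rpow_neg_of_pow_le hs 5754 1019 _ (by norm_num) (by norm_num) (by norm_num) (by norm_num)
  have t4 : (0.019709894 : ℝ) ≤ (1009 / 2 : ℝ) ^ (-s) :=
    le_rpow_neg_of_pow_le hs 14185 2504 _ (by norm_num) (by norm_num) (by norm_num) (by norm_num)
  have t5 : (0.019660760 : ℝ) ≤ (1013 / 2 : ℝ) ^ (-s) :=
    le_rpow_neg_of_pow_le hs 14143 2495 _ (by norm_num) (by norm_num) (by norm_num) (by norm_num)
  have t6 : (0.019563425 : ℝ) ≤ (1021 / 2 : ℝ) ^ (-s) :=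
    le_rpow_neg_of_pow_le hs 7123 1255 _ (by norm_num) (by norm_num) (by norm_num) (by norm_num)
  have t7 : (0.019515218 : ℝ) ≤ (1025 / 2 : ℝ) ^ (-s) :=
    le_rpow_neg_of_pow_le hs 9473 1668 _ (by norm_num) (by norm_num) (by norm_num) (by norm_num)
  have t8 : (0.018871125 : ℝ) ≤ (1081 / 2 : ℝ) ^ (-s) :=
    le_rpow_neg_of_pow_le hs 9044 1579 _ (by norm_num) (by norm_num) (by norm_num) (by norm_num)
  have t9 : (0.018827197 : ℝ) ≤ (1085 / 2 : ℝ) ^ (-s) :=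
    le_rpow_neg_of_pow_le hs 11485 2004 _ (by norm_num) (by norm_num) (by norm_num) (by norm_num)
  have t10 : (0.018740138 : ℝ) ≤ (1093 / 2 : ℝ) ^ (-s) :=
    le_rpow_neg_of_pow_le hs 4791 835 _ (by norm_num) (by norm_num) (by norm_num) (by norm_num)
  have t11 : (0.018696998 : ℝ) ≤ (1097 / 2 : ℝ) ^ (-s) :=
    le_rpow_neg_of_pow_le hs 11706 2039 _ (by norm_num) (by norm_num) (by norm_num) (by norm_num)
  have t12 : (0.018485078 : ℝ) ≤ (1117 / 2 : ℝ) ^ (-s) :=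
    le_rpow_neg_of_pow_le hs 8642 1501 _ (by norm_num) (by norm_num) (by norm_num) (by norm_num)
  have t13 : (0.018443433 : ℝ) ≤ (1121 / 2 : ℝ) ^ (-s) :=
    le_rpow_neg_of_pow_le hs 8307 1442 _ (by norm_num) (by norm_num) (by norm_num) (by norm_num)
  have t14 : (0.018360867 : ℝ) ≤ (1129 / 2 : ℝ) ^ (-s) :=
    le_rpow_neg_of_pow_le hs 12809 2221 _ (by norm_num) (by norm_num) (by norm_num) (by norm_num)
  have t15 : (0.018319941 : ℝ) ≤ (1133 / 2 : ℝ) ^ (-s) :=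
    le_rpow_neg_of_pow_le hs 16867 2923 _ (by norm_num) (by norm_num) (by norm_num) (by norm_num)
  have t16 : (0.016822174 : ℝ) ≤ (1297 / 2 : ℝ) ^ (-s) :=
    le_rpow_neg_of_pow_le hs 39121 6638 _ (by norm_num) (by norm_num) (by norm_num) (by norm_num)
  have t17 : (0.016789531 : ℝ) ≤ (1301 / 2 : ℝ) ^ (-s) :=
    le_rpow_neg_of_pow_le hs 21321 3616 _ (by norm_num) (by norm_num) (by norm_num) (by norm_num)
  have t18 : (0.016724717 : ℝ) ≤ (1309 / 2 : ℝ) ^ (-s) :=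
    le_rpow_neg_of_pow_le hs 5353 907 _ (by norm_num) (by norm_num) (by norm_num) (by norm_num)
  have t19 : (0.016692547 : ℝ) ≤ (1313 / 2 : ℝ) ^ (-s) :=
    le_rpow_neg_of_pow_le hs 15358 2601 _ (by norm_num) (by norm_num) (by norm_num) (by norm_num)
  have t20 : (0.016534092 : ℝ) ≤ (1333 / 2 : ℝ) ^ (-s) :=
    le_rpow_neg_of_pow_le hs 5368 907 _ (by norm_num) (by norm_num) (by norm_num) (by norm_num)
  have t21 : (0.016502863 : ℝ) ≤ (1337 / 2 : ℝ) ^ (-s) :=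
    le_rpow_neg_of_pow_le hs 8935 1509 _ (by norm_num) (by norm_num) (by norm_num) (by norm_num)
  have t22 : (0.016440864 : ℝ) ≤ (1345 / 2 : ℝ) ^ (-s) :=
    le_rpow_neg_of_pow_le hs 6134 1035 _ (by norm_num) (by norm_num) (by norm_num) (by norm_num)
  have t23 : (0.016410089 : ℝ) ≤ (1349 / 2 : ℝ) ^ (-s) :=
    le_rpow_neg_of_pow_le hs 3018 509 _ (by norm_num) (by norm_num) (by norm_num) (by norm_num)
  have t24 : (0.015994325 : ℝ) ≤ (1405 / 2 : ℝ) ^ (-s) :=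
    le_rpow_neg_of_pow_le hs 17171 2878 _ (by norm_num) (by norm_num) (by norm_num) (by norm_num)
  have t25 : (0.015965665 : ℝ) ≤ (1409 / 2 : ℝ) ^ (-s) :=
    le_rpow_neg_of_pow_le hs 9783 1639 _ (by norm_num) (by norm_num) (by norm_num) (by norm_num)
  have t26 : (0.015908737 : ℝ) ≤ (1417 / 2 : ℝ) ^ (-s) :=
    le_rpow_neg_of_pow_le hs 7133 1194 _ (by norm_num) (by norm_num) (by norm_num) (by norm_num)
  have t27 : (0.015880464 : ℝ) ≤ (1421 / 2 : ℝ) ^ (-s) :=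
    le_rpow_neg_of_pow_le hs 6897 1154 _ (by norm_num) (by norm_num) (by norm_num) (by norm_num)
  have t28 : (0.015741042 : ℝ) ≤ (1441 / 2 : ℝ) ^ (-s) :=
    le_rpow_neg_of_pow_le hs 17393 2904 _ (by norm_num) (by norm_num) (by norm_num) (by norm_num)
  have t29 : (0.015713541 : ℝ) ≤ (1445 / 2 : ℝ) ^ (-s) :=
    le_rpow_neg_of_pow_le hs 2205 368 _ (by norm_num) (by norm_num) (by norm_num) (by norm_num)
  have t30 : (0.015658899 : ℝ) ≤ (1453 / 2 : ℝ) ^ (-s) :=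
    le_rpow_neg_of_pow_le hs 11508 1919 _ (by norm_num) (by norm_num) (by norm_num) (by norm_num)
  have t31 : (0.015631762 : ℝ) ≤ (1457 / 2 : ℝ) ^ (-s) :=
    le_rpow_neg_of_pow_le hs 9611 1602 _ (by norm_num) (by norm_num) (by norm_num) (by norm_num)
  have hp : (1.37546 : ℝ) ^ (-s) * Real.log 2 ≤ 0.817803754 * 0.6931471808 :=
    mul_le_mul hu hl2.le hl0.le (by norm_num)
  norm_num [rieszLower] at *
  linarith

set_option exponentiation.threshold 5000 in
lemma log_two_lt_integral_rieszAvg (hs : s = Real.log 2 / Real.log 3)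
    (h : FoldInvariant (1 / 2) μ) (hr : μ.map (fun x => 1 - x) = μ) :
    Real.log 2 * (1.06126 : ℝ) ^ (-s) < ∫ x, rieszAvg μ s (1 + x) ∂μ := by
  have hs0 := (cantorDim_pos hs).le
  have hl2 := Real.log_two_lt_d9
  have hl0 : 0 < Real.log 2 := Real.log_pos (by norm_num)
  have hu : (1.06126 : ℝ) ^ (-s) ≤ 0.96323 :=
    rpow_neg_le_of_pow_le hs 2 37 _ (by norm_num) (by norm_num) (by norm_num) (by norm_num)
      (by norm_num)
  have hp : Real.log 2 * (1.06126 : ℝ) ^ (-s) ≤ 0.6931471808 * 0.96323 :=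
    mul_le_mul hl2.le hu (Real.rpow_nonneg (by norm_num) _) (by norm_num)
  rw [integral_rieszAvg_add_self hs h hr le_rfl]
  norm_num only
  rw [integral_rieszAvg_add_self hs h hr (c := 3) (by norm_num),
    integral_rieszAvg_add_self hs h hr (c := 5) (by norm_num),
    integral_rieszAvg_add_self hs h hr (c := 7) (by norm_num)]
  norm_num only
  have hc := fun (c : ℝ) (hc : 1 ≤ c) => rpow_le_integral_rieszAvg_add hs0 h hc
  have t10 : (0.23390 : ℝ) ≤ (10 : ℝ) ^ (-s) :=
    le_rpow_neg_of_pow_le hs 262 125 _ (by norm_num) (by norm_num) (by norm_num) (by norm_num)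
  have k10 := hc 9 (by norm_num)
  have t12 : (0.20849 : ℝ) ≤ (12 : ℝ) ^ (-s) :=
    le_rpow_neg_of_pow_le hs 95 42 _ (by norm_num) (by norm_num) (by norm_num) (by norm_num)
  have k12 := hc 11 (by norm_num)
  have t14 : (0.18917 : ℝ) ≤ (14 : ℝ) ^ (-s) :=
    le_rpow_neg_of_pow_le hs 221 92 _ (by norm_num) (by norm_num) (by norm_num) (by norm_num)
  have k14 := hc 13 (by norm_num)
  have t16 : (0.17388 : ℝ) ≤ (16 : ℝ) ^ (-s) :=
    le_rpow_neg_of_pow_le hs 53 21 _ (by norm_num) (by norm_num) (by norm_num) (by norm_num)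
  have k16 := hc 15 (by norm_num)
  have t18 : (0.16143 : ℝ) ≤ (18 : ℝ) ^ (-s) :=
    le_rpow_neg_of_pow_le hs 221 84 _ (by norm_num) (by norm_num) (by norm_num) (by norm_num)
  have k18 := hc 17 (by norm_num)
  have t20 : (0.15105 : ℝ) ≤ (20 : ℝ) ^ (-s) :=
    le_rpow_neg_of_pow_le hs 589 216 _ (by norm_num) (by norm_num) (by norm_num) (by norm_num)
  have k20 := hc 19 (by norm_num)
  have t22 : (0.14223 : ℝ) ≤ (22 : ℝ) ^ (-s) :=
    le_rpow_neg_of_pow_le hs 453 161 _ (by norm_num) (by norm_num) (by norm_num) (by norm_num)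
  have k22 := hc 21 (by norm_num)
  have t24 : (0.13463 : ℝ) ≤ (24 : ℝ) ^ (-s) :=
    le_rpow_neg_of_pow_le hs 81 28 _ (by norm_num) (by norm_num) (by norm_num) (by norm_num)
  have k24 := hc 23 (by norm_num)
  have t26 : (0.12800 : ℝ) ≤ (26 : ℝ) ^ (-s) :=
    le_rpow_neg_of_pow_le hs 519 175 _ (by norm_num) (by norm_num) (by norm_num) (by norm_num)
  have k26 := hc 25 (by norm_num)
  norm_num only at *
  linarith

set_option exponentiation.threshold 5000 in
lemma integral_rieszAvg_le (hs : s = Real.log 2 / Real.log 3)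
    (h : FoldInvariant (1 / 2) μ) (hr : μ.map (fun x => 1 - x) = μ)
    (hν : FoldInvariant (27 / 50) ν) :
    ∫ x, rieszAvg μ s (1 + x) ∂ν ≤ 0.6642 := by
  have hs0 := (cantorDim_pos hs).le
  rw [integral_rieszAvg_add hs h hr hν le_rfl]
  norm_num only
  rw [integral_rieszAvg_add hs h hr hν (c := 5) (by norm_num),
    integral_rieszAvg_add hs h hr hν (c := 7) (by norm_num),
    integral_rieszAvg_sub hs h hr hν (c := 4) (by norm_num),
    integral_rieszAvg_sub hs h hr hν (c := 6) (by norm_num)]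
  norm_num only
  have ha := fun (c : ℝ) (hc : 1 ≤ c) => integral_rieszAvg_add_le hs0 h hν hc
  have hb := fun (c : ℝ) (hc : 2 ≤ c) => integral_rieszAvg_sub_le hs0 h hν hc
  have t9 : (9 : ℝ) ^ (-s) ≤ 0.25000 :=
    rpow_neg_le_of_pow_le hs 2 1 _ (by norm_num) (by norm_num) (by norm_num) (by norm_num)
      (by norm_num)
  have t10 : (10 : ℝ) ^ (-s) ≤ 0.23393 :=
    rpow_neg_le_of_pow_le hs 153 73 _ (by norm_num) (by norm_num) (by norm_num) (by norm_num)
      (by norm_num)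
  have t11 : (11 : ℝ) ^ (-s) ≤ 0.22028 :=
    rpow_neg_le_of_pow_le hs 251 115 _ (by norm_num) (by norm_num) (by norm_num) (by norm_num)
      (by norm_num)
  have t12 : (12 : ℝ) ^ (-s) ≤ 0.20852 :=
    rpow_neg_le_of_pow_le hs 432 191 _ (by norm_num) (by norm_num) (by norm_num) (by norm_num)
      (by norm_num)
  have t13 : (13 : ℝ) ^ (-s) ≤ 0.19824 :=
    rpow_neg_le_of_pow_le hs 565 242 _ (by norm_num) (by norm_num) (by norm_num) (by norm_num)
      (by norm_num)
  have t14 : (14 : ℝ) ^ (-s) ≤ 0.18919 :=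
    rpow_neg_le_of_pow_le hs 454 189 _ (by norm_num) (by norm_num) (by norm_num) (by norm_num)
      (by norm_num)
  have t15 : (15 : ℝ) ^ (-s) ≤ 0.18113 :=
    rpow_neg_le_of_pow_le hs 281 114 _ (by norm_num) (by norm_num) (by norm_num) (by norm_num)
      (by norm_num)
  have t16 : (16 : ℝ) ^ (-s) ≤ 0.17391 :=
    rpow_neg_le_of_pow_le hs 641 254 _ (by norm_num) (by norm_num) (by norm_num) (by norm_num)
      (by norm_num)
  have t17 : (17 : ℝ) ^ (-s) ≤ 0.16738 :=
    rpow_neg_le_of_pow_le hs 949 368 _ (by norm_num) (by norm_num) (by norm_num) (by norm_num)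
      (by norm_num)
  have t18 : (18 : ℝ) ^ (-s) ≤ 0.16145 :=
    rpow_neg_le_of_pow_le hs 392 149 _ (by norm_num) (by norm_num) (by norm_num) (by norm_num)
      (by norm_num)
  have t19 : (19 : ℝ) ^ (-s) ≤ 0.15603 :=
    rpow_neg_le_of_pow_le hs 796 297 _ (by norm_num) (by norm_num) (by norm_num) (by norm_num)
      (by norm_num)
  have t20 : (20 : ℝ) ^ (-s) ≤ 0.15107 :=
    rpow_neg_le_of_pow_le hs 469 172 _ (by norm_num) (by norm_num) (by norm_num) (by norm_num)
      (by norm_num)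
  have t21 : (21 : ℝ) ^ (-s) ≤ 0.14649 :=
    rpow_neg_le_of_pow_le hs 327 118 _ (by norm_num) (by norm_num) (by norm_num) (by norm_num)
      (by norm_num)
  have t22 : (22 : ℝ) ^ (-s) ≤ 0.14225 :=
    rpow_neg_le_of_pow_le hs 166 59 _ (by norm_num) (by norm_num) (by norm_num) (by norm_num)
      (by norm_num)
  have t23 : (23 : ℝ) ^ (-s) ≤ 0.13832 :=
    rpow_neg_le_of_pow_le hs 391 137 _ (by norm_num) (by norm_num) (by norm_num) (by norm_num)
      (by norm_num)
  have t24 : (24 : ℝ) ^ (-s) ≤ 0.13466 :=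
    rpow_neg_le_of_pow_le hs 674 233 _ (by norm_num) (by norm_num) (by norm_num) (by norm_num)
      (by norm_num)
  have t25 : (25 : ℝ) ^ (-s) ≤ 0.13123 :=
    rpow_neg_le_of_pow_le hs 460 157 _ (by norm_num) (by norm_num) (by norm_num) (by norm_num)
      (by norm_num)
  have t26 : (26 : ℝ) ^ (-s) ≤ 0.12802 :=
    rpow_neg_le_of_pow_le hs 863 291 _ (by norm_num) (by norm_num) (by norm_num) (by norm_num)
      (by norm_num)
  have t27 : (27 : ℝ) ^ (-s) ≤ 0.12500 :=
    rpow_neg_le_of_pow_le hs 3 1 _ (by norm_num) (by norm_num) (by norm_num) (by norm_num)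
      (by norm_num)
  have a11 := ha 11 (by norm_num)
  have a13 := ha 13 (by norm_num)
  have a17 := ha 17 (by norm_num)
  have a19 := ha 19 (by norm_num)
  have a23 := ha 23 (by norm_num)
  have a25 := ha 25 (by norm_num)
  have b10 := hb 10 (by norm_num)
  have b12 := hb 12 (by norm_num)
  have b16 := hb 16 (by norm_num)
  have b18 := hb 18 (by norm_num)
  have b22 := hb 22 (by norm_num)
  have b24 := hb 24 (by norm_num)
  norm_num only at *
  linarith

lemma log_le_mul_sub_one {y r : ℝ} (k : ℕ) (hr : 0 < r) (hy : 0 < y) (h : y ≤ r ^ k) :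
    Real.log y ≤ k * (r - 1) :=
  calc Real.log y ≤ Real.log (r ^ k) := Real.log_le_log hy h
    _ = k * Real.log r := by rw [Real.log_pow]
    _ ≤ k * (r - 1) :=
      mul_le_mul_of_nonneg_left (Real.log_le_sub_one_of_pos hr) (Nat.cast_nonneg k)

set_option exponentiation.threshold 5000 in
lemma rpow_mul_integral_rieszAvg_le_entropy (hs : s = Real.log 2 / Real.log 3)
    (h : FoldInvariant (1 / 2) μ) (hr : μ.map (fun x => 1 - x) = μ)
    (hν : FoldInvariant (27 / 50) ν) :
    (1.06126 : ℝ) ^ s * ∫ x, rieszAvg μ s (1 + x) ∂ν ≤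
      -(27 / 50 * Real.log (27 / 50) + (1 - 27 / 50) * Real.log (1 - 27 / 50)) := by
  have hI := integral_rieszAvg_le hs h hr hν
  have hl : (0.96311 : ℝ) ≤ (1.06126 : ℝ) ^ (-s) :=
    le_rpow_neg_of_pow_le hs 9 166 _ (by norm_num) (by norm_num) (by norm_num) (by norm_num)
  have hu : (1.06126 : ℝ) ^ s ≤ 1 / 0.96311 := by
    rw [le_div_iff₀ (by norm_num)]
    calc (1.06126 : ℝ) ^ s * 0.96311 ≤ (1.06126 : ℝ) ^ s * (1.06126 : ℝ) ^ (-s) :=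
          mul_le_mul_of_nonneg_left hl (Real.rpow_nonneg (by norm_num) _)
      _ = 1 := by rw [← Real.rpow_add (by norm_num), add_neg_cancel, Real.rpow_zero]
  have hlog := Real.log_two_gt_d9
  have h1 := log_le_mul_sub_one (y := 27 / 25) (r := 1.0012033) 64 (by norm_num) (by norm_num)
    (by norm_num)
  have h2 := log_le_mul_sub_one (y := 23 / 25) (r := 0.9986981) 64 (by norm_num) (by norm_num)
    (by norm_num)
  have e1 : Real.log (27 / 50) = Real.log (27 / 25) - Real.log 2 := by
    rw [← Real.log_div (by norm_num) (by norm_num)]; norm_num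
  have e2 : Real.log (1 - 27 / 50) = Real.log (23 / 25) - Real.log 2 := by
    rw [← Real.log_div (by norm_num) (by norm_num)]; norm_num
  have hmul : (1.06126 : ℝ) ^ s * ∫ x, rieszAvg μ s (1 + x) ∂ν ≤ 1 / 0.96311 * 0.6642 :=
    mul_le_mul hu hI (integral_nonneg_of_ae (hν.supp.mono fun x hx =>
      rieszAvg_nonneg h (by linarith [hx.1]))) (by norm_num)
  rw [e1, e2]
  norm_num at *
  linarith

end Numerics

section Coding

lemma one_sub_mem_preCantorSet (n : ℕ) : ∀ x ∈ preCantorSet n, 1 - x ∈ preCantorSet n := by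
  induction n with
  | zero => exact fun x hx => ⟨by linarith [hx.2], by linarith [hx.1]⟩
  | succ n ih =>
    rintro x (⟨y, hy, rfl⟩ | ⟨y, hy, rfl⟩)
    · exact Or.inr ⟨1 - y, ih y hy, by ring⟩
    · exact Or.inl ⟨1 - y, ih y hy, by ring⟩

lemma one_sub_mem_cantorSet {x : ℝ} (hx : x ∈ cantorSet) : 1 - x ∈ cantorSet :=
  mem_iInter.2 fun n => one_sub_mem_preCantorSet n x (mem_iInter.1 hx n)

lemma foldMap_mem_preCantorSet_succ (b : Bool) (n : ℕ) {x : ℝ} (hx : x ∈ preCantorSet n) :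
    foldMap b x ∈ preCantorSet (n + 1) := by
  cases b
  · exact Or.inl ⟨1 - x, one_sub_mem_preCantorSet n x hx, by simp⟩
  · exact Or.inr ⟨x, hx, by simp⟩

lemma cantorSet_eq_union_image_foldMap :
    cantorSet = foldMap true '' cantorSet ∪ foldMap false '' cantorSet := by
  conv_lhs => rw [cantorSet_eq_union_halves]
  rw [union_comm (foldMap true '' _)]
  congr 1
  ext x
  constructor
  · rintro ⟨y, hy, rfl⟩
    exact ⟨1 - y, one_sub_mem_cantorSet hy, by simp⟩
  · rintro ⟨y, hy, rfl⟩
    exact ⟨1 - y, one_sub_mem_cantorSet hy, by simp⟩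

lemma exists_foldMap_eq {x : ℝ} (hx : x ∈ cantorSet) : ∃ b, ∃ y ∈ cantorSet, foldMap b y = x := by
  rw [cantorSet_eq_union_image_foldMap] at hx
  rcases hx with ⟨y, hy, h⟩ | ⟨y, hy, h⟩
  exacts [⟨true, y, hy, h⟩, ⟨false, y, hy, h⟩]

lemma abs_foldMap_sub (b : Bool) (x y : ℝ) : |foldMap b x - foldMap b y| = |x - y| / 3 := by
  cases b
  · rw [foldMap_false, foldMap_false, ← sub_div, abs_div, abs_of_pos (by norm_num : (0 : ℝ) < 3),
      abs_sub_comm x y]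
    ring_nf
  · rw [foldMap_true, foldMap_true, ← sub_div, abs_div, abs_of_pos (by norm_num : (0 : ℝ) < 3)]
    ring_nf

/-- The `n`-th term of the series for the point with code `w`. -/
def foldTerm (w : ℕ → Bool) (n : ℕ) : ℝ :=
  (∏ i ∈ Finset.range n, bif w i then (1 : ℝ) else -1) * (bif w n then 2 else 1) * (1 / 3) ^ (n + 1)

/-- The point of the Cantor set coded by `w`, the limit of
`foldMap (w 0) ∘ ⋯ ∘ foldMap (w (n - 1))`. -/
def foldCode (w : ℕ → Bool) : ℝ := ∑' n, foldTerm w n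

lemma norm_foldTerm_le (w : ℕ → Bool) (n : ℕ) : ‖foldTerm w n‖ ≤ 2 / 3 * (1 / 3) ^ n := by
  have h1 : ‖∏ i ∈ Finset.range n, bif w i then (1 : ℝ) else -1‖ = 1 := by
    rw [norm_prod]
    exact Finset.prod_eq_one fun i _ => by cases w i <;> simp
  have h2 : ‖(bif w n then 2 else 1 : ℝ)‖ ≤ 2 := by cases w n <;> simp
  rw [foldTerm, norm_mul, norm_mul, h1, one_mul, norm_pow, pow_succ]
  calc _ ≤ 2 * (‖(1 / 3 : ℝ)‖ ^ n * ‖(1 / 3 : ℝ)‖) :=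
        mul_le_mul_of_nonneg_right h2 (by positivity)
    _ = _ := by rw [Real.norm_of_nonneg (by norm_num)]; ring

lemma summable_foldBound : Summable fun n : ℕ => (2 / 3 : ℝ) * (1 / 3) ^ n :=
  (summable_geometric_of_lt_one (by norm_num) (by norm_num)).mul_left _

lemma summable_foldTerm (w : ℕ → Bool) : Summable (foldTerm w) :=
  summable_foldBound.of_norm_bounded (norm_foldTerm_le w)

lemma continuous_foldCode : Continuous foldCode := by
  refine continuous_tsum (fun n => ?_) summable_foldBound (fun n w => norm_foldTerm_le w n)
  have key : ∀ (f : Bool → ℝ) (i : ℕ), Continuous fun w : ℕ → Bool => f (w i) := fun f i =>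
    continuous_of_discreteTopology.comp (continuous_apply i)
  exact ((continuous_finsetProd _ fun i _ => key (fun b => bif b then (1 : ℝ) else -1) i).mul
    (key (fun b => bif b then (2 : ℝ) else 1) n)).mul continuous_const

lemma measurable_foldCode : Measurable foldCode := continuous_foldCode.measurable

lemma foldCode_eq (w : ℕ → Bool) : foldCode w = foldMap (w 0) (foldCode fun n => w (n + 1)) := by
  have hsum := (summable_foldTerm w).tsum_eq_zero_add
  have hsucc : ∀ n, foldTerm w (n + 1) =
      (bif w 0 then (1 : ℝ) else -1) / 3 * foldTerm (fun n => w (n + 1)) n := fun n => by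
    simp only [foldTerm]
    rw [Finset.prod_range_succ']
    ring
  rw [foldCode, hsum, tsum_congr hsucc, tsum_mul_left]
  change _ + _ / 3 * foldCode _ = _
  cases h : w 0 <;> simp [foldTerm, h] <;> ring

lemma foldCode_mem_Icc (w : ℕ → Bool) : foldCode w ∈ Icc (0 : ℝ) 1 := by
  have hle : ∀ w, foldCode w ≤ 1 := fun w => by
    have := tsum_of_norm_bounded (summable_foldBound.hasSum) (norm_foldTerm_le w)
    rw [tsum_mul_left, tsum_geometric_of_lt_one (by norm_num) (by norm_num)] at this
    refine (le_abs_self _).trans (this.trans ?_)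
    norm_num
  have hge : ∀ w, -1 ≤ foldCode w := fun w => by
    have := tsum_of_norm_bounded (summable_foldBound.hasSum) (norm_foldTerm_le w)
    rw [tsum_mul_left, tsum_geometric_of_lt_one (by norm_num) (by norm_num)] at this
    refine le_trans ?_ (neg_le_of_abs_le this)
    norm_num
  refine ⟨?_, hle w⟩
  rw [foldCode_eq]
  have h1 := hle fun n => w (n + 1)
  have h2 := hge fun n => w (n + 1)
  cases w 0 <;> simp <;> linarith

lemma foldCode_mem_cantorSet (w : ℕ → Bool) : foldCode w ∈ cantorSet := by
  have : ∀ n w, foldCode w ∈ preCantorSet n := fun n => by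
    induction n with
    | zero => exact foldCode_mem_Icc
    | succ n ih =>
      intro w
      rw [foldCode_eq]
      exact foldMap_mem_preCantorSet_succ _ n (ih _)
  exact mem_iInter.2 fun n => this n w

lemma abs_foldCode_sub_le (n : ℕ) : ∀ w w' : ℕ → Bool, (∀ i < n, w i = w' i) →
    |foldCode w - foldCode w'| ≤ (1 / 3) ^ n := by
  induction n with
  | zero =>
    intro w w' _
    have h1 := foldCode_mem_Icc w
    have h2 := foldCode_mem_Icc w'
    rw [pow_zero, abs_le]
    constructor <;> linarith [h1.1, h1.2, h2.1, h2.2]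
  | succ n ih =>
    intro w w' h
    rw [foldCode_eq w, foldCode_eq w', h 0 n.succ_pos, abs_foldMap_sub, pow_succ]
    linarith [ih (fun i => w (i + 1)) (fun i => w' (i + 1)) fun i hi => h _ (by omega)]

lemma eq_of_abs_foldCode_sub_lt (n : ℕ) : ∀ w w' : ℕ → Bool,
    |foldCode w - foldCode w'| < (1 / 3) ^ n → ∀ i < n, w i = w' i := by
  induction n with
  | zero => exact fun w w' _ i hi => absurd hi i.not_lt_zero
  | succ n ih =>
    intro w w' h
    have hpow : (1 / 3 : ℝ) ^ n ≤ 1 := pow_le_one₀ (by norm_num) (by norm_num)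
    have h0 : w 0 = w' 0 := by
      by_contra hne
      rw [foldCode_eq w, foldCode_eq w', pow_succ, abs_lt] at h
      have h1 := foldCode_mem_Icc fun i => w (i + 1)
      have h2 := foldCode_mem_Icc fun i => w' (i + 1)
      cases hw : w 0 <;> cases hw' : w' 0 <;> simp_all <;> linarith [h1.1, h1.2, h2.1, h2.2]
    rw [foldCode_eq w, foldCode_eq w', h0, abs_foldMap_sub, pow_succ] at h
    have := ih (fun i => w (i + 1)) (fun i => w' (i + 1)) (by linarith)
    intro i hi
    cases i with
    | zero => exact h0
    | succ i => exact this i (by omega)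

lemma cantorSet_subset_range_foldCode : cantorSet ⊆ range foldCode := by
  have hstep : ∀ x : cantorSet, ∃ q : Bool × cantorSet, foldMap q.1 (q.2 : ℝ) = x := fun x => by
    obtain ⟨b, y, hy, h⟩ := exists_foldMap_eq x.2
    exact ⟨(b, ⟨y, hy⟩), h⟩
  choose g hg using hstep
  have key : ∀ n (x : cantorSet),
      |(x : ℝ) - foldCode fun k => (g ((fun z => (g z).2)^[k] x)).1| ≤ (1 / 3) ^ n := fun n => by
    induction n with
    | zero =>
      intro x
      have h1 := cantorSet_subset_unitInterval x.2
      have h2 := foldCode_mem_Icc fun k => (g ((fun z => (g z).2)^[k] x)).1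
      rw [pow_zero, abs_le]
      constructor <;> linarith [h1.1, h1.2, h2.1, h2.2]
    | succ n ih =>
      intro x
      rw [foldCode_eq]
      conv_lhs => rw [← hg x]
      simp only [Function.iterate_zero, id_eq, Function.iterate_succ_apply]
      rw [abs_foldMap_sub, pow_succ]
      linarith [ih (g x).2]
  intro x hx
  refine ⟨fun k => (g ((fun z => (g z).2)^[k] ⟨x, hx⟩)).1, ?_⟩
  have hlim := tendsto_pow_atTop_nhds_zero_of_lt_one (r := (1 / 3 : ℝ)) (by norm_num) (by norm_num)
  have := ge_of_tendsto' hlim fun n => key n ⟨x, hx⟩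
  exact (sub_eq_zero.1 (abs_nonpos_iff.1 this)).symm

end Coding

section CodeMeasure

/-- The measure on `Bool` giving mass `p` to `true` and `1 - p` to `false`. -/
def bitMeasure (p : unitInterval) : Measure Bool :=
  ENNReal.ofReal p • Measure.dirac true + ENNReal.ofReal (1 - p) • Measure.dirac false

instance (p : unitInterval) : IsProbabilityMeasure (bitMeasure p) := by
  constructor
  simp only [bitMeasure, Measure.add_apply, Measure.smul_apply, measure_univ, smul_eq_mul, mul_one]
  rw [← ENNReal.ofReal_add p.2.1 (sub_nonneg.2 p.2.2), add_sub_cancel, ENNReal.ofReal_one]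

/-- The weight of the bit `b`. -/
def bitWeight (p : unitInterval) (b : Bool) : ℝ := bif b then (p : ℝ) else 1 - p

lemma bitWeight_nonneg (p : unitInterval) (b : Bool) : 0 ≤ bitWeight p b := by
  cases b
  · exact sub_nonneg.2 p.2.2
  · exact p.2.1

lemma bitMeasure_singleton (p : unitInterval) (b : Bool) :
    bitMeasure p {b} = ENNReal.ofReal (bitWeight p b) := by
  cases b <;> simp [bitMeasure, bitWeight]

/-- The law of an i.i.d. sequence of bits. -/
def codeMeasure (p : unitInterval) : Measure (ℕ → Bool) := Measure.infinitePi fun _ => bitMeasure p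

instance (p : unitInterval) : IsProbabilityMeasure (codeMeasure p) := by
  unfold codeMeasure; infer_instance

lemma codeMeasure_cylinder (p : unitInterval) (w : ℕ → Bool) (n : ℕ) :
    codeMeasure p {w' | ∀ i < n, w' i = w i} =
      ENNReal.ofReal (∏ i ∈ Finset.range n, bitWeight p (w i)) := by
  have : {w' : ℕ → Bool | ∀ i < n, w' i = w i} = Set.pi (Finset.range n) fun i => {w i} := by
    ext w'; simp [Set.mem_pi]
  rw [this, codeMeasure, Measure.infinitePi_pi _ fun i _ => measurableSet_singleton _,
    ENNReal.ofReal_prod_of_nonneg fun i _ => bitWeight_nonneg p _]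
  exact Finset.prod_congr rfl fun i _ => bitMeasure_singleton p _

/-- Prepend a bit to a sequence. -/
def consBit (b : Bool) (w : ℕ → Bool) : ℕ → Bool
  | 0 => b
  | n + 1 => w n

lemma measurable_consBit (b : Bool) : Measurable (consBit b) := by
  refine measurable_pi_iff.2 fun n => ?_
  cases n with
  | zero => exact measurable_const
  | succ n => exact measurable_pi_apply n

lemma foldCode_consBit (b : Bool) (w : ℕ → Bool) : foldCode (consBit b w) = foldMap b (foldCode w) :=
  foldCode_eq _

lemma codeMeasure_eq (p : unitInterval) :
    codeMeasure p = ENNReal.ofReal p • (codeMeasure p).map (consBit true) +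
      ENNReal.ofReal (1 - p) • (codeMeasure p).map (consBit false) := by
  refine (Measure.eq_infinitePi (fun _ => bitMeasure p) fun s t ht => ?_).symm
  classical
  obtain ⟨N, hN⟩ : ∃ N, s ⊆ Finset.range (N + 1) := by
    obtain ⟨N, hN⟩ := s.exists_nat_subset_range
    exact ⟨N, hN.trans (Finset.range_mono N.le_succ)⟩
  set u : ℕ → Set Bool := fun i => if i ∈ s then t i else univ with hu
  have hum : ∀ i, MeasurableSet (u i) := fun i => MeasurableSet.of_discrete
  have e1 : Set.pi (s : Set ℕ) t = Set.pi (Finset.range (N + 1)) u := by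
    ext w
    simp only [Set.mem_pi, Finset.mem_coe, hu]
    constructor
    · intro h i _
      split_ifs with hi
      exacts [h i hi, mem_univ _]
    · intro h i hi
      simpa [hi] using h i (hN hi)
  have e2 : ∏ i ∈ s, bitMeasure p (t i) = ∏ i ∈ Finset.range (N + 1), bitMeasure p (u i) := by
    rw [← Finset.prod_subset hN fun i _ hi => by simp only [hu, if_neg hi, measure_univ]]
    exact Finset.prod_congr rfl fun i hi => by simp [hu, hi]
  have e3 : ∀ b, (codeMeasure p).map (consBit b) (Set.pi (Finset.range (N + 1)) u) =
      (u 0).indicator 1 b * ∏ i ∈ Finset.range N, bitMeasure p (u (i + 1)) := fun b => by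
    rw [Measure.map_apply (measurable_consBit b)
      (MeasurableSet.pi (Finset.countable_toSet _) fun i _ => hum i)]
    by_cases hb : b ∈ u 0
    · have : consBit b ⁻¹' Set.pi (Finset.range (N + 1)) u =
          Set.pi (Finset.range N) fun i => u (i + 1) := by
        ext w
        simp only [mem_preimage, Set.mem_pi, Finset.mem_coe, Finset.mem_range]
        constructor
        · exact fun h i hi => h (i + 1) (by omega)
        · intro h i hi
          cases i with
          | zero => exact hb
          | succ i => exact h i (by omega)
      rw [this, codeMeasure, Measure.infinitePi_pi _ fun i _ => hum _]
      simp [hb]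
    · have : consBit b ⁻¹' Set.pi (Finset.range (N + 1)) u = ∅ := by
        refine eq_empty_of_forall_notMem fun w hw => hb ?_
        exact hw 0 (by simp)
      rw [this, measure_empty, indicator_of_notMem hb, zero_mul]
  rw [e1, e2, Measure.add_apply, Measure.smul_apply, Measure.smul_apply, e3, e3,
    Finset.prod_range_succ', smul_eq_mul, smul_eq_mul, ← mul_assoc, ← mul_assoc, ← add_mul,
    mul_comm]
  congr 1
  simp [bitMeasure]

lemma foldInvariant_map_foldCode (p : unitInterval) :
    FoldInvariant p ((codeMeasure p).map foldCode) where
  isProb := Measure.isProbabilityMeasure_map measurable_foldCode.aemeasurable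
  nonneg := p.2.1
  le_one := p.2.2
  supp := (ae_map_iff measurable_foldCode.aemeasurable measurableSet_Icc).2
    (Eventually.of_forall foldCode_mem_Icc)
  eq := by
    conv_lhs => rw [codeMeasure_eq]
    rw [Measure.map_add _ _ measurable_foldCode, Measure.map_smul, Measure.map_smul]
    simp only [Measure.map_map measurable_foldCode (measurable_consBit _),
      Measure.map_map (measurable_foldMap _) measurable_foldCode]
    congr 3 <;> exact funext fun w => foldCode_consBit _ w

/-- The left shift. -/
def shiftCode (w : ℕ → Bool) : ℕ → Bool := fun n => w (n + 1)

lemma shiftCode_iterate (k : ℕ) (w : ℕ → Bool) : shiftCode^[k] w = fun n => w (n + k) := by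
  induction k generalizing w with
  | zero => rfl
  | succ k ih =>
    rw [Function.iterate_succ_apply, ih]
    funext n
    simp only [shiftCode]
    congr 1

lemma measurePreserving_shiftCode (p : unitInterval) :
    MeasurePreserving shiftCode (codeMeasure p) (codeMeasure p) := by
  have hm : Measurable shiftCode := measurable_pi_iff.2 fun n => measurable_pi_apply (n + 1)
  refine ⟨hm, ?_⟩
  conv_lhs => rw [codeMeasure_eq]
  have hc : ∀ b, shiftCode ∘ consBit b = id := fun b => rfl
  rw [Measure.map_add _ _ hm, Measure.map_smul, Measure.map_smul,
    Measure.map_map hm (measurable_consBit _), Measure.map_map hm (measurable_consBit _), hc, hc,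
    Measure.map_id, ← add_smul, ← ENNReal.ofReal_add p.2.1 (sub_nonneg.2 p.2.2), add_sub_cancel,
    ENNReal.ofReal_one, one_smul]

lemma measurePreserving_shiftCode_iterate (p : unitInterval) (k : ℕ) :
    MeasurePreserving shiftCode^[k] (codeMeasure p) (codeMeasure p) :=
  (measurePreserving_shiftCode p).iterate k

/-- The mass distribution principle for images of cylinder measures. -/
lemma hausdorffMeasure_foldCode_image_ne_zero (P : Measure (ℕ → Bool)) [IsFiniteMeasure P]
    {E : Set (ℕ → Bool)} {d : ℝ} (hd : 0 < d) {N : ℕ}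
    (hE : ∀ w ∈ E, ∀ n, N ≤ n →
      P {w' | ∀ i < n, w' i = w i} ≤ ENNReal.ofReal (((1 / 3 : ℝ) ^ n) ^ d)) (hP : P E ≠ 0) :
    μH[d] (foldCode '' E) ≠ 0 := by
  set ρ : Measure ℝ := ENNReal.ofReal ((1 / 9 : ℝ) ^ d) • (P.restrict E).map foldCode with hρ
  have h3 : 0 < (1 / 9 : ℝ) ^ d := by positivity
  have hle : ρ ≤ μH[d] := by
    refine Measure.le_hausdorffMeasure d ρ (ENNReal.ofReal ((1 / 3) ^ (N + 2)))
      (ENNReal.ofReal_pos.2 (by positivity)) fun S hS => ?_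
    have hcl : ρ S ≤ ENNReal.ofReal ((1 / 9 : ℝ) ^ d) * P (foldCode ⁻¹' closure S ∩ E) := by
      refine (measure_mono subset_closure).trans (le_of_eq ?_)
      rw [hρ, Measure.smul_apply, smul_eq_mul, Measure.map_apply measurable_foldCode
        isClosed_closure.measurableSet, Measure.restrict_apply
        (measurable_foldCode isClosed_closure.measurableSet)]
    refine hcl.trans ?_
    rw [← ediam_closure S] at hS ⊢
    rcases (foldCode ⁻¹' closure S ∩ E).eq_empty_or_nonempty with h0 | ⟨w, hw, hwE⟩
    · simp [h0]
    have hfin : ediam (closure S) ≠ ⊤ := ne_top_of_le_ne_top ENNReal.ofReal_ne_top hS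
    set δ := (ediam (closure S)).toReal with hδ
    have hδe : ediam (closure S) = ENNReal.ofReal δ := (ENNReal.ofReal_toReal hfin).symm
    have hδ0 : 0 ≤ δ := ENNReal.toReal_nonneg
    rw [hδe] at hS ⊢
    rw [ENNReal.ofReal_le_ofReal_iff (by positivity)] at hS
    have hbound : ∀ n, N ≤ n → δ < (1 / 3) ^ n →
        P (foldCode ⁻¹' closure S ∩ E) ≤ ENNReal.ofReal (((1 / 3 : ℝ) ^ n) ^ d) := by
      intro n hn hlt
      refine (measure_mono fun w' hw' => ?_).trans (hE w hwE n hn)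
      refine eq_of_abs_foldCode_sub_lt n _ _ (lt_of_le_of_lt ?_ hlt)
      rw [← Real.dist_eq, ← ENNReal.ofReal_le_ofReal_iff hδ0, ← edist_dist, ← hδe]
      exact edist_le_ediam_of_mem hw'.1 hw
    rcases hδ0.eq_or_lt with h0 | hpos
    · have : P (foldCode ⁻¹' closure S ∩ E) = 0 := by
        have hlim : Tendsto (fun n : ℕ => ENNReal.ofReal (((1 / 3 : ℝ) ^ n) ^ d)) atTop (𝓝 0) := by
          have h1 := (tendsto_pow_atTop_nhds_zero_of_lt_one (r := (1 / 3 : ℝ)) (by norm_num)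
            (by norm_num)).rpow_const (p := d) (Or.inr hd.le)
          rw [Real.zero_rpow hd.ne'] at h1
          simpa using ENNReal.tendsto_ofReal h1
        refine le_antisymm (ge_of_tendsto hlim ?_) zero_le
        filter_upwards [eventually_ge_atTop N] with n hn
        exact hbound n hn (by rw [← h0]; positivity)
      simp [this]
    · obtain ⟨n, hn1, hn2⟩ := exists_nat_pow_near_of_lt_one hpos
        (hS.trans (pow_le_one₀ (by norm_num) (by norm_num))) (by norm_num : (0 : ℝ) < 1 / 3)
        (by norm_num)
      have hlt : N + 2 < n + 1 := by
        by_contra hcon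
        have : (1 / 3 : ℝ) ^ (N + 2) ≤ (1 / 3) ^ (n + 1) :=
          pow_le_pow_of_le_one (by norm_num) (by norm_num) (by omega)
        linarith
      obtain ⟨m, rfl⟩ : ∃ m, n = m + 1 := ⟨n - 1, by omega⟩
      have hm := hbound m (by omega) (hn2.trans_lt
        (pow_lt_pow_right_of_lt_one₀ (by norm_num) (by norm_num) m.lt_succ_self))
      calc _ ≤ ENNReal.ofReal ((1 / 9 : ℝ) ^ d) * ENNReal.ofReal (((1 / 3 : ℝ) ^ m) ^ d) := by gcongr
        _ = ENNReal.ofReal (((1 / 3 : ℝ) ^ (m + 1 + 1)) ^ d) := by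
          rw [← ENNReal.ofReal_mul h3.le, ← Real.mul_rpow (by norm_num) (by positivity)]
          congr 2
          ring
        _ ≤ ENNReal.ofReal (δ ^ d) :=
          ENNReal.ofReal_le_ofReal (Real.rpow_le_rpow (by positivity) hn1.le hd.le)
        _ = _ := (ENNReal.ofReal_rpow_of_pos hpos).symm
  intro h0
  have h1 : ρ (foldCode '' E) = 0 := le_antisymm ((hle _).trans h0.le) zero_le
  rw [hρ, Measure.smul_apply, smul_eq_mul, mul_eq_zero] at h1
  rcases h1 with h1 | h1
  · exact (ENNReal.ofReal_pos.2 h3).ne' h1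
  · refine hP (le_antisymm ?_ zero_le)
    rw [← h1, ← Measure.restrict_apply_self P E]
    exact (measure_mono (subset_preimage_image _ _)).trans
      (Measure.le_map_apply measurable_foldCode.aemeasurable _)

end CodeMeasure

section CantorMeasure

variable {s : ℝ}

lemma third_pow_rpow (hs : s = Real.log 2 / Real.log 3) (n : ℕ) :
    ((1 / 3 : ℝ) ^ n) ^ s = (1 / 2) ^ n := by
  rw [← Real.rpow_natCast, ← Real.rpow_mul (by norm_num), mul_comm, Real.rpow_mul (by norm_num),
    Real.rpow_natCast, Real.div_rpow (by norm_num) (by norm_num), three_rpow hs, Real.one_rpow]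

lemma ofReal_half_pow_mul (n : ℕ) : (2 : ℝ≥0∞) ^ n * ENNReal.ofReal ((1 / 2) ^ n) = 1 := by
  have : (2 : ℝ≥0∞) ^ n = ENNReal.ofReal (2 ^ n) := by
    rw [ENNReal.ofReal_pow (by norm_num), ENNReal.ofReal_ofNat]
  rw [this, ← ENNReal.ofReal_mul (by positivity), ← mul_pow]
  norm_num

lemma hausdorffMeasure_cantorSet_ne_top (hs : s = Real.log 2 / Real.log 3) :
    μH[s] cantorSet ≠ ⊤ := by
  have hs0 := cantorDim_pos hs
  have hdiam : ∀ n (v : Fin n → Bool),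
      ediam (foldCode '' {w | ∀ i : Fin n, w i = v i}) ≤ ENNReal.ofReal ((1 / 3) ^ n) := by
    rintro n v
    refine ediam_le ?_
    rintro _ ⟨w, hw, rfl⟩ _ ⟨w', hw', rfl⟩
    rw [edist_dist, Real.dist_eq]
    refine ENNReal.ofReal_le_ofReal (abs_foldCode_sub_le n w w' fun i hi => ?_)
    exact (hw ⟨i, hi⟩).trans (hw' ⟨i, hi⟩).symm
  have hlim : Tendsto (fun n : ℕ => ENNReal.ofReal ((1 / 3 : ℝ) ^ n)) atTop (𝓝 0) := by
    simpa using ENNReal.tendsto_ofReal (tendsto_pow_atTop_nhds_zero_of_lt_one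
      (r := (1 / 3 : ℝ)) (by norm_num) (by norm_num))
  have key := Measure.hausdorffMeasure_le_liminf_sum s cantorSet _ hlim
    (fun n (v : Fin n → Bool) => foldCode '' {w | ∀ i : Fin n, w i = v i})
    (Eventually.of_forall hdiam) (Eventually.of_forall fun n x hx => by
      obtain ⟨w, rfl⟩ := cantorSet_subset_range_foldCode hx
      exact mem_iUnion.2 ⟨fun i => w i, w, fun i => rfl, rfl⟩)
  refine ne_top_of_le_ne_top ENNReal.one_ne_top (key.trans ?_)
  refine liminf_le_of_le (by isBoundedDefault) fun b hb => ?_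
  obtain ⟨n, hn⟩ := hb.exists
  refine hn.trans ?_
  calc ∑ v : Fin n → Bool, ediam (foldCode '' {w | ∀ i : Fin n, w i = v i}) ^ s
      ≤ ∑ _v : Fin n → Bool, ENNReal.ofReal ((1 / 3) ^ n) ^ s :=
        Finset.sum_le_sum fun v _ => ENNReal.rpow_le_rpow (hdiam n v) hs0.le
    _ = 1 := by
      rw [ENNReal.ofReal_rpow_of_pos (by positivity), third_pow_rpow hs]
      simpa using ofReal_half_pow_mul n

/-- The weight `1 / 2`. -/
def halfWeight : unitInterval := ⟨1 / 2, by norm_num, by norm_num⟩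

lemma hausdorffMeasure_cantorSet_ne_zero (hs : s = Real.log 2 / Real.log 3) :
    μH[s] cantorSet ≠ 0 := by
  have := hausdorffMeasure_foldCode_image_ne_zero (codeMeasure halfWeight) (E := univ)
    (cantorDim_pos hs) (N := 0) (fun w _ n _ => by
      rw [codeMeasure_cylinder, third_pow_rpow hs, Finset.prod_eq_pow_card (b := 1 / 2),
        Finset.card_range]
      intro i _
      cases w i <;> norm_num [bitWeight, halfWeight]) (by simp)
  refine fun h0 => this (le_antisymm ((measure_mono ?_).trans h0.le) zero_le)
  rintro _ ⟨w, _, rfl⟩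
  exact foldCode_mem_cantorSet w

lemma hausdorffMeasure_foldMap_image (hs : s = Real.log 2 / Real.log 3) (b : Bool) (A : Set ℝ) :
    μH[s] (foldMap b '' A) = ENNReal.ofReal (1 / 2) * μH[s] A := by
  have hs0 := cantorDim_pos hs
  have hL : LipschitzWith (1 / 3) (foldMap b) := LipschitzWith.of_dist_le_mul fun x y => by
    rw [Real.dist_eq, Real.dist_eq, abs_foldMap_sub]
    simp only [NNReal.coe_div, NNReal.coe_one, NNReal.coe_ofNat]
    linarith
  have hA : AntilipschitzWith 3 (foldMap b) := AntilipschitzWith.of_le_mul_dist fun x y => by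
    rw [Real.dist_eq, Real.dist_eq, abs_foldMap_sub]
    simp only [NNReal.coe_ofNat]
    linarith
  have e3 : (((3 : NNReal) : ℝ≥0∞)) ^ s = 2 := by
    have : ((3 : NNReal) : ℝ≥0∞) = ENNReal.ofReal 3 := by simp
    rw [this, ENNReal.ofReal_rpow_of_pos (by norm_num), three_rpow hs, ENNReal.ofReal_ofNat]
  have e1 : (((1 / 3 : NNReal) : ℝ≥0∞)) ^ s = ENNReal.ofReal (1 / 2) := by
    have : ((1 / 3 : NNReal) : ℝ≥0∞) = ENNReal.ofReal (1 / 3) := by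
      rw [ENNReal.ofReal]; congr 1
      ext
      norm_num
    rw [this, ENNReal.ofReal_rpow_of_pos (by norm_num)]
    have := third_pow_rpow hs 1
    rw [pow_one, pow_one] at this
    rw [this]
  have h12 : ENNReal.ofReal (1 / 2) * 2 = 1 := by
    have := ofReal_half_pow_mul 1
    rwa [pow_one, pow_one, mul_comm] at this
  refine le_antisymm ?_ ?_
  · rw [← e1]
    exact hL.hausdorffMeasure_image_le hs0.le A
  · have := hA.le_hausdorffMeasure_image hs0.le A
    rw [e3] at this
    calc _ ≤ ENNReal.ofReal (1 / 2) * (2 * μH[s] (foldMap b '' A)) := by gcongr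
      _ = _ := by rw [← mul_assoc, h12, one_mul]

lemma foldInvariant_cantor (hs : s = Real.log 2 / Real.log 3) :
    FoldInvariant (1 / 2) ((μH[s] cantorSet)⁻¹ • (μH[s]).restrict cantorSet) where
  isProb := ⟨by
    rw [Measure.smul_apply, Measure.restrict_apply_univ, smul_eq_mul]
    exact ENNReal.inv_mul_cancel (hausdorffMeasure_cantorSet_ne_zero hs)
      (hausdorffMeasure_cantorSet_ne_top hs)⟩
  nonneg := by norm_num
  le_one := by norm_num
  supp := Measure.ae_smul_measure ((ae_restrict_mem isClosed_cantorSet.measurableSet).mono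
    fun x hx => cantorSet_subset_unitInterval hx) _
  eq := by
    refine Measure.ext fun A hA => ?_
    have hpre : ∀ b, μH[s] (foldMap b '' cantorSet ∩ A) =
        ENNReal.ofReal (1 / 2) * μH[s] (foldMap b ⁻¹' A ∩ cantorSet) := fun b => by
      rw [← hausdorffMeasure_foldMap_image hs, inter_comm (foldMap b ⁻¹' A), image_inter_preimage]
    have hmeas : MeasurableSet (foldMap false '' cantorSet ∩ A) :=
      (isCompact_cantorSet.image (continuous_foldMap false)).measurableSet.inter hA
    have hdisj : Disjoint (foldMap true '' cantorSet ∩ A) (foldMap false '' cantorSet ∩ A) := by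
      rw [Set.disjoint_left]
      rintro _ ⟨⟨x, hx, rfl⟩, -⟩ ⟨⟨y, hy, hxy⟩, -⟩
      rw [foldMap_false, foldMap_true] at hxy
      linarith [(cantorSet_subset_unitInterval hx).1, (cantorSet_subset_unitInterval hy).1]
    have hsplit : A ∩ cantorSet = foldMap true '' cantorSet ∩ A ∪ foldMap false '' cantorSet ∩ A := by
      rw [← union_inter_distrib_right, ← cantorSet_eq_union_image_foldMap, inter_comm]
    simp only [Measure.map_smul, Measure.add_apply, Measure.smul_apply, smul_eq_mul]
    rw [Measure.restrict_apply hA, Measure.map_apply (measurable_foldMap _) hA,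
      Measure.map_apply (measurable_foldMap _) hA,
      Measure.restrict_apply (measurable_foldMap _ hA),
      Measure.restrict_apply (measurable_foldMap _ hA), hsplit, measure_union hdisj hmeas, hpre,
      hpre]
    norm_num only
    ring

lemma map_one_sub_cantor (s : ℝ) :
    ((μH[s] cantorSet)⁻¹ • (μH[s]).restrict cantorSet).map (fun x : ℝ => 1 - x) =
      (μH[s] cantorSet)⁻¹ • (μH[s]).restrict cantorSet := by
  refine Measure.ext fun A hA => ?_
  have hm : Measurable fun x : ℝ => 1 - x := by fun_prop
  have hX : (fun x : ℝ => 1 - x) ⁻¹' A ∩ cantorSet = (fun x : ℝ => 1 - x) ⁻¹' (A ∩ cantorSet) := by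
    ext x
    simp only [mem_inter_iff, mem_preimage]
    refine and_congr_right fun _ => ⟨one_sub_mem_cantorSet, fun h => ?_⟩
    simpa using one_sub_mem_cantorSet h
  rw [Measure.map_smul, Measure.smul_apply, Measure.smul_apply, Measure.map_apply hm hA,
    Measure.restrict_apply (hm hA), Measure.restrict_apply hA, hX]
  congr 1
  exact (IsometryEquiv.subLeft (1 : ℝ)).hausdorffMeasure_preimage s _

lemma dimH_cantorSet_le (hs : s = Real.log 2 / Real.log 3) : dimH cantorSet ≤ ENNReal.ofReal s := by
  refine dimH_le_of_hausdorffMeasure_ne_top ?_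
  rw [Real.coe_toNNReal _ (cantorDim_pos hs).le]
  exact hausdorffMeasure_cantorSet_ne_top hs

end CantorMeasure

section LawOfLargeNumbers

open ProbabilityTheory

lemma sum_range_mul_eq (g : ℕ → ℝ) (m N : ℕ) :
    ∑ k ∈ Finset.range (N * m), g k =
      ∑ r ∈ Finset.range m, ∑ j ∈ Finset.range N, g (j * m + r) := by
  induction N with
  | zero => simp
  | succ N ih =>
    simp only [Finset.sum_range_succ, Finset.sum_add_distrib]
    rw [← ih, Nat.succ_mul, Finset.sum_range_add]

lemma tendsto_average_of_subsampled {g : ℕ → ℝ} {C : ℝ} {m : ℕ} (hm : 0 < m) (hg : ∀ k, |g k| ≤ C)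
    (h : ∀ r, Tendsto (fun N : ℕ => (∑ j ∈ Finset.range N, g (j * m + r)) / N) atTop (𝓝 0)) :
    Tendsto (fun n : ℕ => (∑ k ∈ Finset.range n, g k) / n) atTop (𝓝 0) := by
  have hC : 0 ≤ C := (abs_nonneg _).trans (hg 0)
  have h1 : Tendsto (fun N : ℕ => (∑ k ∈ Finset.range (N * m), g k) / N) atTop (𝓝 0) := by
    have := tendsto_finsetSum (Finset.range m) fun r _ => h r
    simp only [Finset.sum_const_zero] at this
    refine this.congr fun N => ?_
    rw [sum_range_mul_eq, Finset.sum_div]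
  have h2 := (h1.comp (Nat.tendsto_div_const_atTop hm.ne')).abs
  have h3 : Tendsto (fun n : ℕ => m * C / n) atTop (𝓝 0) := tendsto_const_div_atTop_nhds_zero_nat _
  have h4 := h2.add h3
  rw [abs_zero, add_zero] at h4
  refine squeeze_zero_norm' (Eventually.of_forall fun n => ?_) h4
  simp only [Function.comp_apply]
  set q := n / m with hq
  have hn : n = q * m + n % m := by rw [hq, mul_comm]; exact (Nat.div_add_mod n m).symm
  have hqn : q ≤ n := Nat.div_le_self n m
  have hrest : |∑ k ∈ Finset.range (n % m), g (q * m + k)| ≤ m * C := by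
    refine (Finset.abs_sum_le_sum_abs _ _).trans ((Finset.sum_le_sum fun k _ => hg _).trans ?_)
    rw [Finset.sum_const, Finset.card_range, nsmul_eq_mul]
    exact mul_le_mul_of_nonneg_right (by exact_mod_cast (Nat.mod_lt n hm).le) hC
  have hsum : ∑ k ∈ Finset.range n, g k =
      ∑ k ∈ Finset.range (q * m), g k + ∑ k ∈ Finset.range (n % m), g (q * m + k) := by
    conv_lhs => rw [hn, Finset.sum_range_add]
  rw [hsum, add_div, Real.norm_eq_abs]
  refine (abs_add_le _ _).trans (add_le_add ?_ ?_)
  · rcases Nat.eq_zero_or_pos q with h0 | h0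
    · simp [h0]
    · rw [abs_div, abs_div, Nat.abs_cast, Nat.abs_cast]
      gcongr
  · rw [abs_div, Nat.abs_cast]
    gcongr

lemma measurable_window (m k : ℕ) : Measurable fun (w : ℕ → Bool) (i : Fin m) => w (k + i) :=
  measurable_pi_iff.2 fun i => measurable_pi_apply (k + (i : ℕ))

lemma iterate_shiftCode_apply (k i : ℕ) (w : ℕ → Bool) : shiftCode^[k] w i = w (k + i) := by
  rw [shiftCode_iterate, add_comm]

lemma tendsto_average_block (p : unitInterval) {m : ℕ} (G : (Fin m → Bool) → ℝ) (r : ℕ) :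
    ∀ᵐ w ∂codeMeasure p, Tendsto
      (fun N : ℕ => (∑ j ∈ Finset.range N, G fun i => w (j * m + r + i)) / N) atTop
      (𝓝 (∫ w, G (fun i => w i) ∂codeMeasure p)) := by
  have hGm : Measurable G := Measurable.of_discrete
  have hmeas : ∀ k, Measurable fun w : ℕ → Bool => G fun i => w (k + i) := fun k =>
    hGm.comp (measurable_window m k)
  have hid : ∀ k, IdentDistrib (fun w : ℕ → Bool => G fun i => w (k + i))
      (fun w : ℕ → Bool => G fun i => w i) (codeMeasure p) (codeMeasure p) := fun k => by
    have h0 : Measurable fun w : ℕ → Bool => G fun i => w i := by simpa using hmeas 0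
    refine ⟨(hmeas k).aemeasurable, h0.aemeasurable, ?_⟩
    conv_rhs => rw [← (measurePreserving_shiftCode_iterate p k).map_eq,
      Measure.map_map h0 (measurePreserving_shiftCode_iterate p k).measurable]
    congr 1
    funext w
    simp only [Function.comp_apply, iterate_shiftCode_apply]
  have hind : iIndepFun (fun (i : ℕ) (w : ℕ → Bool) => w i) (codeMeasure p) :=
    iIndepFun_infinitePi (X := fun _ b => b) fun _ => measurable_id
  have hpair : Pairwise fun j k => IndepFun (fun w : ℕ → Bool => G fun i => w (j * m + r + i))
      (fun w : ℕ → Bool => G fun i => w (k * m + r + i)) (codeMeasure p) := by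
    intro j k hjk
    have hmem : ∀ j (i : Fin m), j * m + r + i ∈ Finset.Ico (j * m + r) (j * m + r + m) :=
      fun j i => Finset.mem_Ico.2 ⟨by omega, by omega⟩
    have hdisj : Disjoint (Finset.Ico (j * m + r) (j * m + r + m))
        (Finset.Ico (k * m + r) (k * m + r + m)) := by
      rw [Finset.disjoint_left]
      intro a ha hb
      rw [Finset.mem_Ico] at ha hb
      rcases lt_or_gt_of_ne hjk with h | h
      · have := Nat.mul_le_mul_right m (Nat.succ_le_of_lt h)
        rw [Nat.succ_mul] at this
        omega
      · have := Nat.mul_le_mul_right m (Nat.succ_le_of_lt h)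
        rw [Nat.succ_mul] at this
        omega
    have := (hind.indepFun_finset _ _ hdisj fun i => measurable_pi_apply i).comp
      (φ := fun v => G fun i => v ⟨_, hmem j i⟩) (ψ := fun v => G fun i => v ⟨_, hmem k i⟩)
      (by fun_prop) (by fun_prop)
    exact this
  have hint : Integrable (fun w : ℕ → Bool => G fun i => w (0 * m + r + i)) (codeMeasure p) := by
    obtain ⟨C, hC⟩ := (Set.finite_range fun v => ‖G v‖).bddAbove
    exact Integrable.of_bound (hmeas _).aestronglyMeasurable C
      (Eventually.of_forall fun w => hC (mem_range_self _))
  have := strong_law_ae_real (fun j (w : ℕ → Bool) => G fun i => w (j * m + r + i)) hint hpair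
    fun j => (hid _).trans (hid _).symm
  rwa [(hid _).integral_eq] at this

/-- Extend a finite word by `false`. -/
def extendWord {m : ℕ} (v : Fin m → Bool) (i : ℕ) : Bool := if h : i < m then v ⟨i, h⟩ else false

theorem tendsto_birkhoffAverage_shiftCode (p : unitInterval) {g : (ℕ → Bool) → ℝ}
    (hg : Measurable g) {C : ℝ} (hC : ∀ w, |g w| ≤ C)
    (hu : ∀ ε > 0, ∃ m : ℕ, ∀ w w' : ℕ → Bool, (∀ i < m, w i = w' i) → |g w - g w'| ≤ ε) :
    ∀ᵐ w ∂codeMeasure p, Tendsto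
      (fun n : ℕ => (∑ k ∈ Finset.range n, g (shiftCode^[k] w)) / n) atTop
      (𝓝 (∫ w, g w ∂codeMeasure p)) := by
  have hgi : Integrable g (codeMeasure p) :=
    Integrable.of_bound hg.aestronglyMeasurable C (Eventually.of_forall hC)
  set c : ℕ → ℝ := fun m => ∫ w, g (extendWord fun i : Fin m => w i) ∂codeMeasure p with hc
  have hext : ∀ m, Integrable (fun w : ℕ → Bool => g (extendWord fun i : Fin m => w i))
      (codeMeasure p) := fun m => by
    have hG : Measurable fun v : Fin m → Bool => g (extendWord v) := Measurable.of_discrete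
    have hw : Measurable fun (w : ℕ → Bool) (i : Fin m) => w i := by fun_prop
    exact Integrable.of_bound (hG.comp hw).aestronglyMeasurable C
      (Eventually.of_forall fun w => hC _)
  have hall : ∀ᵐ w ∂codeMeasure p, ∀ (m r : ℕ), Tendsto (fun N : ℕ =>
      (∑ j ∈ Finset.range N, (g (extendWord fun i : Fin m => w (j * m + r + i)) - c m)) / N)
      atTop (𝓝 0) := by
    refine ae_all_iff.2 fun m => ae_all_iff.2 fun r => ?_
    have := tendsto_average_block p (fun v : Fin m → Bool => g (extendWord v) - c m) r
    rwa [integral_sub (hext m) (integrable_const _), integral_const, probReal_univ, one_smul,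
      sub_self] at this
  filter_upwards [hall] with w hw
  have hcC : ∀ m, |c m| ≤ C := fun m => by
    have := norm_integral_le_of_norm_le_const (μ := codeMeasure p) (C := C)
      (f := fun w => g (extendWord fun i : Fin m => w i)) (Eventually.of_forall fun w => hC _)
    simpa using this
  rw [Metric.tendsto_atTop]
  intro ε hε
  obtain ⟨m, hm⟩ := hu (ε / 4) (by positivity)
  have hclose : ∀ v : ℕ → Bool, |g v - g (extendWord fun i : Fin (m + 1) => v i)| ≤ ε / 4 :=
    fun v => hm _ _ fun i hi => by rw [extendWord, dif_pos (by omega)]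
  have hmean : |(∫ w, g w ∂codeMeasure p) - c (m + 1)| ≤ ε / 4 := by
    rw [hc, ← integral_sub hgi (hext _)]
    have := norm_integral_le_of_norm_le_const (μ := codeMeasure p) (C := ε / 4)
      (f := fun w => g w - g (extendWord fun i : Fin (m + 1) => w i)) (Eventually.of_forall hclose)
    simpa using this
  have hlim := tendsto_average_of_subsampled (C := C + C) m.succ_pos
    (g := fun k => g (extendWord fun i : Fin (m + 1) => w (k + i)) - c (m + 1))
    (fun k => (abs_sub _ _).trans (add_le_add (hC _) (hcC _))) fun r => hw (m + 1) r
  obtain ⟨N, hN⟩ := Metric.tendsto_atTop.1 hlim (ε / 4) (by positivity)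
  refine ⟨N + 1, fun n hn => ?_⟩
  have hn0 : (0 : ℝ) < n := by exact_mod_cast (by omega : 0 < n)
  have h1 := hN n (by omega)
  rw [Real.dist_eq, sub_zero] at h1
  have h2 : |(∑ k ∈ Finset.range n, g (shiftCode^[k] w)) / n -
      (∑ k ∈ Finset.range n, (g (extendWord fun i : Fin (m + 1) => w (k + i)) - c (m + 1))) / n -
      c (m + 1)| ≤ ε / 4 := by
    have e : (∑ k ∈ Finset.range n, g (shiftCode^[k] w)) / n -
      (∑ k ∈ Finset.range n, (g (extendWord fun i : Fin (m + 1) => w (k + i)) - c (m + 1))) / n -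
      c (m + 1) = (∑ k ∈ Finset.range n, (g (shiftCode^[k] w) -
        g (extendWord fun i : Fin (m + 1) => shiftCode^[k] w i))) / n := by
      simp only [iterate_shiftCode_apply, Finset.sum_sub_distrib, Finset.sum_const,
        Finset.card_range, nsmul_eq_mul]
      field_simp
      ring
    rw [e, abs_div, Nat.abs_cast, div_le_iff₀ hn0]
    refine (Finset.abs_sum_le_sum_abs _ _).trans ((Finset.sum_le_sum fun k _ => hclose _).trans ?_)
    rw [Finset.sum_const, Finset.card_range, nsmul_eq_mul, mul_comm]
  rw [Real.dist_eq]
  rw [abs_le] at h2 hmean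
  rw [abs_lt] at h1 ⊢
  constructor <;> linarith [h1.1, h1.2, h2.1, h2.2, hmean.1, hmean.2]

end LawOfLargeNumbers

/-- The Riesz potential of order `s` of `μ`, with the kernel truncated at distance `t`. -/
def truncPotential (μ : Measure ℝ) (s x t : ℝ) : ℝ := ∫ y, (max t |x - y|) ^ (-s) ∂μ

lemma integral_indicator_lt_mul_rpow {s t d : ℝ} (hs : 0 < s) (ht : 0 < t) (ht1 : t ≤ 1)
    (hd : d ≤ 1) :
    ∫ ρ in t..1, (if d < ρ then ρ ^ (-s - 1) else 0) = ((max t d) ^ (-s) - 1) / s := by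
  have hm0 : 0 < max t d := lt_max_of_lt_left ht
  have hm1 : max t d ≤ 1 := max_le ht1 hd
  rw [intervalIntegral.integral_of_le ht1]
  have h1 : ∫ ρ in Ioc t 1, (if d < ρ then ρ ^ (-s - 1) else 0) =
      ∫ ρ in Ioc t 1, (Ioi d).indicator (fun ρ => ρ ^ (-s - 1)) ρ := by
    refine integral_congr_ae (Eventually.of_forall fun ρ => ?_)
    simp [indicator]
  rw [h1, setIntegral_indicator measurableSet_Ioi]
  have h2 : Ioc t 1 ∩ Ioi d = Ioc (max t d) 1 := by
    ext ρ
    simp only [mem_inter_iff, mem_Ioc, mem_Ioi, max_lt_iff]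
    tauto
  rw [h2, ← intervalIntegral.integral_of_le hm1, integral_rpow]
  · rw [Real.one_rpow, show -s - 1 + 1 = -s by ring]
    field_simp
    ring
  · right
    refine ⟨by linarith, ?_⟩
    rw [uIcc_of_le hm1]
    intro h
    exact absurd h.1 (not_le.2 hm0)

lemma measurable_max_rpow (s t x : ℝ) : Measurable fun y : ℝ => (max t |x - y|) ^ (-s) :=
  ((by fun_prop : Measurable fun y => max t |x - y|)).pow_const _

lemma abs_max_rpow_le {s t : ℝ} (hs : 0 < s) (ht : 0 < t) (x y : ℝ) :
    |(max t |x - y|) ^ (-s)| ≤ t ^ (-s) := by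
  have : 0 < max t |x - y| := lt_max_of_lt_left ht
  rw [abs_of_nonneg (Real.rpow_nonneg this.le _)]
  exact Real.rpow_le_rpow_of_nonpos ht (le_max_left _ _) (by linarith)

lemma integral_measure_ball_mul_rpow {μ : Measure ℝ} {p s x t : ℝ} (h : FoldInvariant p μ)
    (hs : 0 < s) (hx : x ∈ Icc (0 : ℝ) 1) (ht : 0 < t) (ht1 : t ≤ 1) :
    ∫ ρ in t..1, (μ (ball x ρ)).toReal * ρ ^ (-s - 1) = (truncPotential μ s x t - 1) / s := by
  have := h.isProb
  have hm : Measurable (Function.uncurry fun ρ y : ℝ => if |x - y| < ρ then ρ ^ (-s - 1) else 0) := by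
    refine Measurable.ite ?_ ?_ measurable_const
    · exact measurableSet_lt (by fun_prop) (by fun_prop)
    · exact measurable_fst.pow_const _
  have hb : ∀ ρ y : ℝ, t < ρ → |if |x - y| < ρ then ρ ^ (-s - 1) else 0| ≤ t ^ (-s - 1) := by
    intro ρ y hρ
    have h1 : 0 ≤ ρ ^ (-s - 1) := Real.rpow_nonneg (ht.trans hρ).le _
    have h2 : ρ ^ (-s - 1) ≤ t ^ (-s - 1) :=
      Real.rpow_le_rpow_of_nonpos ht hρ.le (by linarith)
    split_ifs
    · rwa [abs_of_nonneg h1]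
    · simpa using h1.trans h2
  have h1 : ∀ ρ : ℝ, (μ (ball x ρ)).toReal * ρ ^ (-s - 1) =
      ∫ y, (if |x - y| < ρ then ρ ^ (-s - 1) else 0) ∂μ := by
    intro ρ
    have : (fun y => if |x - y| < ρ then ρ ^ (-s - 1) else 0) =
        (ball x ρ).indicator fun _ => ρ ^ (-s - 1) := by
      ext y
      simp [indicator, Real.dist_eq, abs_sub_comm]
    rw [this, integral_indicator measurableSet_ball, setIntegral_const, smul_eq_mul]
    rfl
  simp_rw [h1]
  rw [intervalIntegral.integral_of_le ht1, integral_integral_swap]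
  · simp_rw [← intervalIntegral.integral_of_le ht1]
    have h2 : ∀ᵐ y ∂μ, ∫ ρ in t..1, (if |x - y| < ρ then ρ ^ (-s - 1) else 0) =
        ((max t |x - y|) ^ (-s) - 1) / s := by
      filter_upwards [h.supp] with y hy
      refine integral_indicator_lt_mul_rpow hs ht ht1 ?_
      rw [abs_le]
      constructor <;> linarith [hx.1, hx.2, hy.1, hy.2]
    rw [integral_congr_ae h2, integral_div, integral_sub, truncPotential]
    · simp
    · exact h.integrable (measurable_max_rpow s t x) fun y _ => abs_max_rpow_le hs ht x y
    · exact integrable_const _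
  · refine Integrable.of_bound (C := t ^ (-s - 1)) hm.aestronglyMeasurable ?_
    have h3 : ∀ᵐ q ∂((volume.restrict (Ioc t 1)).prod μ), q ∈ Ioc t 1 ×ˢ (univ : Set ℝ) := by
      have : ((volume.restrict (Ioc t 1)).prod μ) = (volume.prod μ).restrict (Ioc t 1 ×ˢ univ) := by
        rw [← Measure.prod_restrict, Measure.restrict_univ]
      rw [this]
      exact ae_restrict_mem (measurableSet_Ioc.prod MeasurableSet.univ)
    filter_upwards [h3] with q hq
    exact hb q.1 q.2 hq.1.1

lemma truncPotential_one {μ : Measure ℝ} {p s x : ℝ} (h : FoldInvariant p μ)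
    (hx : x ∈ Icc (0 : ℝ) 1) : truncPotential μ s x 1 = 1 := by
  have := h.isProb
  have h2 : ∀ᵐ y ∂μ, (max 1 |x - y|) ^ (-s) = 1 := by
    filter_upwards [h.supp] with y hy
    rw [max_eq_left, Real.one_rpow]
    rw [abs_le]
    constructor <;> linarith [hx.1, hx.2, hy.1, hy.2]
  rw [truncPotential, integral_congr_ae h2]
  simp

lemma truncPotential_foldMap {μ : Measure ℝ} {s x t : ℝ} (h : FoldInvariant (1 / 2) μ)
    (hs : s = Real.log 2 / Real.log 3) (b : Bool) (hx : x ∈ Icc (0 : ℝ) 1) (ht : 0 < t)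
    (ht1 : t ≤ 1) :
    truncPotential μ s (foldMap b x) (t / 3) = truncPotential μ s x t + rieszAvg μ s (1 + x) := by
  have := h.isProb
  have hs0 := cantorDim_pos hs
  have hsame : ∀ y, |foldMap b x - foldMap b y| = |x - y| / 3 := fun y => abs_foldMap_sub b x y
  have hdiff : ∀ y ∈ Icc (0 : ℝ) 1, |foldMap b x - foldMap (!b) y| = (1 + x + y) / 3 := by
    intro y hy
    cases b
    · simp only [foldMap_false, Bool.not_false, foldMap_true]
      rw [abs_of_nonpos (by linarith [hx.1, hy.1])]
      ring
    · simp only [foldMap_false, Bool.not_true, foldMap_true]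
      rw [abs_of_nonneg (by linarith [hx.1, hy.1])]
      ring
  have key := h.integral_eq (measurable_max_rpow s (t / 3) (foldMap b x))
    fun y _ => abs_max_rpow_le hs0 (by positivity) (foldMap b x) y
  have e1 : ∫ y, (max (t / 3) |foldMap b x - foldMap b y|) ^ (-s) ∂μ =
      2 * truncPotential μ s x t := by
    rw [truncPotential, ← integral_const_mul]
    refine integral_congr_ae (Eventually.of_forall fun y => ?_)
    simp only [hsame, max_div_div_right (by norm_num : (0 : ℝ) ≤ 3)]
    exact div_three_rpow_neg hs (ht.le.trans (le_max_left _ _))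
  have e2 : ∫ y, (max (t / 3) |foldMap b x - foldMap (!b) y|) ^ (-s) ∂μ =
      2 * rieszAvg μ s (1 + x) := by
    rw [rieszAvg, ← integral_const_mul]
    refine integral_congr_ae ?_
    filter_upwards [h.supp] with y hy
    simp only [hdiff y hy, max_div_div_right (by norm_num : (0 : ℝ) ≤ 3)]
    rw [max_eq_right (by linarith [hx.1, hy.1])]
    exact div_three_rpow_neg hs (by linarith [hx.1, hy.1])
  rw [truncPotential, key]
  cases b
  · rw [Bool.not_false] at e2
    rw [e1, e2]; ring
  · rw [Bool.not_true] at e2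
    rw [e1, e2]; ring

section Orbit

variable {μ : Measure ℝ} {s p : ℝ}

lemma abs_truncPotential_le (h : FoldInvariant p μ) {t : ℝ} (hs : 0 < s) (ht : 0 < t) (x : ℝ) :
    |truncPotential μ s x t| ≤ t ^ (-s) := by
  have := h.isProb
  have := norm_integral_le_of_norm_le_const (μ := μ) (C := t ^ (-s))
    (f := fun y => (max t |x - y|) ^ (-s)) (Eventually.of_forall fun y => abs_max_rpow_le hs ht x y)
  simpa [truncPotential] using this

lemma truncPotential_anti (h : FoldInvariant p μ) (hs : 0 < s) {t u : ℝ} (ht : 0 < t)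
    (htu : t ≤ u) (x : ℝ) : truncPotential μ s x u ≤ truncPotential μ s x t := by
  have hi : ∀ v : ℝ, 0 < v → Integrable (fun y => (max v |x - y|) ^ (-s)) μ := fun v hv =>
    h.integrable (measurable_max_rpow s v x) fun y _ => abs_max_rpow_le hs hv x y
  refine integral_mono (hi u (ht.trans_le htu)) (hi t ht) fun y => ?_
  exact Real.rpow_le_rpow_of_nonpos (lt_max_of_lt_left ht) (max_le_max_right _ htu) (by linarith)

lemma measurable_truncPotential [SFinite μ] (s t : ℝ) :
    Measurable fun x => truncPotential μ s x t := by
  have hm : Measurable (Function.uncurry fun x y : ℝ => (max t |x - y|) ^ (-s)) :=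
    (by fun_prop : Measurable fun q : ℝ × ℝ => max t |q.1 - q.2|).pow_const _
  exact hm.stronglyMeasurable.integral_prod_right.measurable

lemma integral_truncPotential_pow (h : FoldInvariant (1 / 2) μ)
    (hs : s = Real.log 2 / Real.log 3) (n : ℕ) :
    ∫ x, truncPotential μ s x ((1 / 3) ^ n) ∂μ = 1 + n * ∫ x, rieszAvg μ s (1 + x) ∂μ := by
  have := h.isProb
  have hs0 := cantorDim_pos hs
  induction n with
  | zero =>
    have : ∀ᵐ x ∂μ, truncPotential μ s x ((1 / 3) ^ 0) = 1 := by
      filter_upwards [h.supp] with x hx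
      rw [pow_zero, truncPotential_one h hx]
    rw [integral_congr_ae this]
    simp
  | succ n ih =>
    have ht : (0 : ℝ) < (1 / 3) ^ n := by positivity
    have hi : Integrable (fun x => truncPotential μ s x ((1 / 3) ^ n)) μ :=
      h.integrable (measurable_truncPotential s _) fun x _ => abs_truncPotential_le h hs0 ht x
    have hb : ∀ b, ∫ x, truncPotential μ s (foldMap b x) ((1 / 3) ^ (n + 1)) ∂μ =
        1 + n * ∫ x, rieszAvg μ s (1 + x) ∂μ + ∫ x, rieszAvg μ s (1 + x) ∂μ := by
      intro b
      rw [← ih, ← integral_add hi (integrable_rieszAvg_add h h hs0.le le_rfl)]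
      refine integral_congr_ae ?_
      filter_upwards [h.supp] with x hx
      rw [pow_succ, mul_one_div, truncPotential_foldMap h hs b hx ht
        (pow_le_one₀ (by norm_num) (by norm_num))]
    rw [h.integral_eq (measurable_truncPotential s _) fun x _ =>
      abs_truncPotential_le h hs0 (by positivity) x, hb, hb]
    push_cast
    ring

/-- The sum of `rieszAvg μ s (1 + ·)` along the first `n` points of the orbit of a code. -/
def orbitSum (μ : Measure ℝ) (s : ℝ) (w : ℕ → Bool) (n : ℕ) : ℝ :=
  ∑ k ∈ Finset.range n, rieszAvg μ s (1 + foldCode (shiftCode^[k + 1] w))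

lemma truncPotential_foldCode (h : FoldInvariant (1 / 2) μ)
    (hs : s = Real.log 2 / Real.log 3) (n : ℕ) : ∀ w : ℕ → Bool,
    truncPotential μ s (foldCode w) ((1 / 3) ^ n) = 1 + orbitSum μ s w n := by
  induction n with
  | zero =>
    intro w
    rw [pow_zero, truncPotential_one h (foldCode_mem_Icc w)]
    simp [orbitSum]
  | succ n ih =>
    intro w
    rw [foldCode_eq w, pow_succ, mul_one_div, truncPotential_foldMap h hs _ (foldCode_mem_Icc _)
      (by positivity) (pow_le_one₀ (by norm_num) (by norm_num))]
    have : truncPotential μ s (foldCode fun n => w (n + 1)) ((1 / 3) ^ n) =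
      1 + orbitSum μ s (shiftCode w) n := ih (shiftCode w)
    rw [this, orbitSum, orbitSum, Finset.sum_range_succ' _ n, ← add_assoc]
    rfl

lemma orbitSum_le (h : FoldInvariant (1 / 2) μ) (hs : 0 ≤ s) (w : ℕ → Bool) (n : ℕ) :
    orbitSum μ s w n ≤ n := by
  have : orbitSum μ s w n ≤ ∑ k ∈ Finset.range n, (1 : ℝ) := Finset.sum_le_sum fun k _ =>
    (le_abs_self _).trans (abs_rieszAvg_add_le h hs le_rfl _ (foldCode_mem_Icc _))
  simpa using this

lemma le_orbitSum (h : FoldInvariant (1 / 2) μ) (hs : 0 ≤ s) (w : ℕ → Bool) (n : ℕ) :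
    n * rieszAvg μ s 2 ≤ orbitSum μ s w n := by
  have : ∑ k ∈ Finset.range n, rieszAvg μ s 2 ≤ orbitSum μ s w n :=
    Finset.sum_le_sum fun k _ => by
      have := foldCode_mem_Icc (shiftCode^[k + 1] w)
      exact rieszAvg_anti h hs (by linarith [this.1]) (by linarith [this.2])
  simpa using this

lemma orbitSum_nonneg (h : FoldInvariant (1 / 2) μ) (hs : 0 ≤ s) (w : ℕ → Bool) (n : ℕ) :
    0 ≤ orbitSum μ s w n :=
  (mul_nonneg n.cast_nonneg (rieszAvg_nonneg h two_pos)).trans (le_orbitSum h hs w n)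

lemma avgA_eq (h : FoldInvariant p μ) (hs : s = Real.log 2 / Real.log 3)
    {x t : ℝ} (hx : x ∈ Icc (0 : ℝ) 1) (ht : 0 < t) (ht1 : t ≤ 1) :
    avgA μ s x t = (truncPotential μ s x t - 1) / (Real.log 2 * (-Real.log t / Real.log 3)) := by
  have hs0 := cantorDim_pos hs
  have h3 : 0 < Real.log 3 := Real.log_pos (by norm_num)
  have h2 : 0 < Real.log 2 := Real.log_pos (by norm_num)
  rw [avgA, integral_measure_ball_mul_rpow h hs0 hx ht ht1, hs, div_mul_div_comm, one_mul]
  congr 1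
  field_simp

/-- The generation of `t`: the largest `n` such that `t ≤ 3⁻ⁿ`. -/
def triadicLevel (t : ℝ) : ℕ := ⌊-Real.log t / Real.log 3⌋₊

lemma tendsto_triadicLevel : Tendsto triadicLevel (𝓝[>] 0) atTop := by
  have h3 : 0 < Real.log 3 := Real.log_pos (by norm_num)
  refine tendsto_nat_floor_atTop.comp (Tendsto.atTop_div_const h3 ?_)
  exact tendsto_neg_atBot_atTop.comp Real.tendsto_log_nhdsGT_zero

lemma avgA_mem_Icc (h : FoldInvariant (1 / 2) μ) (hs : s = Real.log 2 / Real.log 3)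
    (w : ℕ → Bool) {t : ℝ} (ht : 0 < t) (ht1 : t < 1) (hn : 0 < triadicLevel t) :
    avgA μ s (foldCode w) t ∈ Icc
      (orbitSum μ s w (triadicLevel t) / (Real.log 2 * (triadicLevel t + 1 : ℕ)))
      (orbitSum μ s w (triadicLevel t + 1) / (Real.log 2 * triadicLevel t)) := by
  have hs0 := cantorDim_pos hs
  have h3 : 0 < Real.log 3 := Real.log_pos (by norm_num)
  have h2 : 0 < Real.log 2 := Real.log_pos (by norm_num)
  set n := triadicLevel t with hnd
  have hlt : Real.log t < 0 := Real.log_neg ht ht1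
  have hq0 : 0 ≤ -Real.log t / Real.log 3 := div_nonneg (by linarith) h3.le
  have hn1 : (n : ℝ) ≤ -Real.log t / Real.log 3 := Nat.floor_le hq0
  have hn2 : -Real.log t / Real.log 3 < n + 1 := Nat.lt_floor_add_one _
  have hn0 : (0 : ℝ) < n := by exact_mod_cast hn
  have hpow : ∀ m : ℕ, Real.log ((1 / 3 : ℝ) ^ m) = -(m * Real.log 3) := by
    intro m
    rw [Real.log_pow, one_div, Real.log_inv]; ring
  have ht2 : t ≤ (1 / 3) ^ n := by
    rw [← Real.log_le_log_iff ht (by positivity), hpow]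
    rw [le_div_iff₀ h3] at hn1
    linarith
  have ht3 : (1 / 3) ^ (n + 1) ≤ t := by
    rw [← Real.log_le_log_iff (by positivity) ht, hpow]
    rw [div_lt_iff₀ h3] at hn2
    push_cast
    linarith
  have e1 := truncPotential_anti h hs0 ht ht2 (foldCode w)
  have e2 := truncPotential_anti h hs0 (by positivity) ht3 (foldCode w)
  rw [truncPotential_foldCode h hs] at e1 e2
  rw [avgA_eq h hs (foldCode_mem_Icc w) ht ht1.le]
  constructor
  · refine div_le_div₀ ?_ (by linarith) (mul_pos h2 (hn0.trans_le hn1)) ?_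
    · linarith [orbitSum_nonneg h hs0.le w n]
    · push_cast
      gcongr
  · refine div_le_div₀ (orbitSum_nonneg h hs0.le w _) (by linarith) (mul_pos h2 hn0) ?_
    gcongr

lemma eventually_avgA_mem_Icc (h : FoldInvariant (1 / 2) μ) (hs : s = Real.log 2 / Real.log 3)
    (w : ℕ → Bool) : ∀ᶠ t in 𝓝[>] (0 : ℝ), avgA μ s (foldCode w) t ∈ Icc
      (orbitSum μ s w (triadicLevel t) / (Real.log 2 * (triadicLevel t + 1 : ℕ)))
      (orbitSum μ s w (triadicLevel t + 1) / (Real.log 2 * triadicLevel t)) := by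
  filter_upwards [Ioo_mem_nhdsGT (zero_lt_one (α := ℝ)), tendsto_triadicLevel.eventually_gt_atTop 0]
    with t ht hn
  exact avgA_mem_Icc h hs w ht.1 ht.2 hn

lemma tendsto_natCast_div_succ : Tendsto (fun n : ℕ => (n : ℝ) / (n + 1 : ℕ)) atTop (𝓝 1) := by
  push_cast
  exact tendsto_natCast_div_add_atTop 1

lemma tendsto_succ_div_natCast : Tendsto (fun n : ℕ => ((n + 1 : ℕ) : ℝ) / n) atTop (𝓝 1) := by
  have := tendsto_natCast_div_succ.inv₀ one_ne_zero
  simpa using this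

lemma tendsto_avgA (h : FoldInvariant (1 / 2) μ) (hs : s = Real.log 2 / Real.log 3)
    {w : ℕ → Bool} {L : ℝ} (hL : Tendsto (fun n : ℕ => orbitSum μ s w n / n) atTop (𝓝 L)) :
    Tendsto (fun t => avgA μ s (foldCode w) t) (𝓝[>] 0) (𝓝 (L / Real.log 2)) := by
  have hlo : Tendsto (fun n : ℕ => orbitSum μ s w n / (Real.log 2 * (n + 1 : ℕ))) atTop
      (𝓝 (L / Real.log 2)) := by
    have := (hL.mul tendsto_natCast_div_succ).div_const (Real.log 2)
    rw [mul_one] at this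
    refine this.congr' ?_
    filter_upwards [eventually_gt_atTop 0] with n hn
    have : (n : ℝ) ≠ 0 := by positivity
    field_simp
  have hhi : Tendsto (fun n : ℕ => orbitSum μ s w (n + 1) / (Real.log 2 * n)) atTop
      (𝓝 (L / Real.log 2)) := by
    have := ((hL.comp (tendsto_add_atTop_nat 1)).mul tendsto_succ_div_natCast).div_const
      (Real.log 2)
    rw [mul_one] at this
    refine this.congr' ?_
    filter_upwards [eventually_gt_atTop 0] with n hn
    have : (n : ℝ) ≠ 0 := by positivity
    have : ((n + 1 : ℕ) : ℝ) ≠ 0 := by positivity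
    simp only [Function.comp]
    field_simp
  have hev := eventually_avgA_mem_Icc h hs w
  exact tendsto_of_tendsto_of_tendsto_of_le_of_le' (hlo.comp tendsto_triadicLevel)
    (hhi.comp tendsto_triadicLevel) (hev.mono fun t ht => ht.1) (hev.mono fun t ht => ht.2)

lemma eventually_avgA_le (h : FoldInvariant (1 / 2) μ) (hs : s = Real.log 2 / Real.log 3)
    (w : ℕ → Bool) : ∀ᶠ t in 𝓝[>] (0 : ℝ), avgA μ s (foldCode w) t ≤ 2 / Real.log 2 := by
  have h2 : 0 < Real.log 2 := Real.log_pos (by norm_num)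
  filter_upwards [eventually_avgA_mem_Icc h hs w, tendsto_triadicLevel.eventually_gt_atTop 0]
    with t ht hn
  have h1 := orbitSum_le h (cantorDim_pos hs).le w (triadicLevel t + 1)
  have hn1 : (1 : ℝ) ≤ triadicLevel t := by exact_mod_cast hn
  refine ht.2.trans ?_
  rw [div_le_div_iff₀ (by positivity) h2]
  push_cast at h1
  nlinarith

lemma eventually_avgA_nonneg (h : FoldInvariant (1 / 2) μ) (hs : s = Real.log 2 / Real.log 3)
    (w : ℕ → Bool) : ∀ᶠ t in 𝓝[>] (0 : ℝ), 0 ≤ avgA μ s (foldCode w) t := by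
  have h2 : 0 < Real.log 2 := Real.log_pos (by norm_num)
  filter_upwards [eventually_avgA_mem_Icc h hs w] with t ht
  exact (div_nonneg (orbitSum_nonneg h (cantorDim_pos hs).le w _) (by positivity)).trans ht.1

lemma le_lowerAvg (h : FoldInvariant (1 / 2) μ) (hs : s = Real.log 2 / Real.log 3)
    {x : ℝ} (hx : x ∈ cantorSet) : rieszAvg μ s 2 / Real.log 2 ≤ lowerAvg μ s x := by
  obtain ⟨w, rfl⟩ := cantorSet_subset_range_foldCode hx
  have h2 : 0 < Real.log 2 := Real.log_pos (by norm_num)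
  have hlo : Tendsto (fun n : ℕ => n * rieszAvg μ s 2 / (Real.log 2 * (n + 1 : ℕ))) atTop
      (𝓝 (rieszAvg μ s 2 / Real.log 2)) := by
    have := tendsto_natCast_div_succ.mul_const (rieszAvg μ s 2 / Real.log 2)
    rw [one_mul] at this
    refine this.congr fun n => ?_
    rw [div_mul_div_comm, mul_comm (Real.log 2)]
  have hlo' := hlo.comp tendsto_triadicLevel
  rw [lowerAvg, ← hlo'.liminf_eq]
  refine liminf_le_liminf ?_ hlo'.isBoundedUnder_ge ?_
  · filter_upwards [eventually_avgA_mem_Icc h hs w] with t ht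
    refine le_trans ?_ ht.1
    simp only [Function.comp]
    gcongr
    exact le_orbitSum h (cantorDim_pos hs).le w _
  · exact (isBoundedUnder_of_eventually_le (eventually_avgA_le h hs w)).isCoboundedUnder_ge

lemma tendsto_avgA_of_upperAvg_eq_lowerAvg (h : FoldInvariant (1 / 2) μ)
    (hs : s = Real.log 2 / Real.log 3) {x α : ℝ} (hx : x ∈ cantorSet)
    (hu : upperAvg μ s x = α) (hl : lowerAvg μ s x = α) :
    Tendsto (fun t => avgA μ s x t) (𝓝[>] 0) (𝓝 α) := by
  obtain ⟨w, rfl⟩ := cantorSet_subset_range_foldCode hx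
  exact tendsto_of_liminf_eq_limsup hl hu
    (isBoundedUnder_of_eventually_le (eventually_avgA_le h hs w))
    (isBoundedUnder_of_eventually_ge (eventually_avgA_nonneg h hs w))

end Orbit

section Almost

variable {μ : Measure ℝ} {s : ℝ}

lemma eq_integral_rieszAvg_of_tendsto_avgA (h : FoldInvariant (1 / 2) μ)
    (hs : s = Real.log 2 / Real.log 3) (hX : ∀ᵐ x ∂μ, x ∈ cantorSet) {α : ℝ}
    (hα : ∀ᵐ x ∂μ, Tendsto (fun t => avgA μ s x t) (𝓝[>] 0) (𝓝 α)) :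
    α = (∫ x, rieszAvg μ s (1 + x) ∂μ) / Real.log 2 := by
  have := h.isProb
  have hs0 := cantorDim_pos hs
  have h3 : 0 < Real.log 3 := Real.log_pos (by norm_num)
  have h2 : 0 < Real.log 2 := Real.log_pos (by norm_num)
  set E := ∫ x, rieszAvg μ s (1 + x) ∂μ
  let u : ℕ → ℝ → ℝ := fun n x => (truncPotential μ s x ((1 / 3) ^ n) - 1) / n
  have hpow : Tendsto (fun n : ℕ => (1 / 3 : ℝ) ^ n) atTop (𝓝[>] 0) :=
    tendsto_pow_atTop_nhdsWithin_zero_of_lt_one (by norm_num) (by norm_num)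
  have hlim : ∀ᵐ x ∂μ, Tendsto (fun n => u n x) atTop (𝓝 (α * Real.log 2)) := by
    filter_upwards [h.supp, hα] with x hx hxα
    refine ((hxα.comp hpow).mul_const (Real.log 2)).congr' ?_
    filter_upwards [eventually_gt_atTop 0] with n hn
    have hn0 : (n : ℝ) ≠ 0 := by positivity
    simp only [Function.comp, u]
    rw [avgA_eq h hs hx (by positivity) (pow_le_one₀ (by norm_num) (by norm_num)), Real.log_pow,
      one_div, Real.log_inv]
    field_simp
  have hbound : ∀ n, ∀ᵐ x ∂μ, ‖u n x‖ ≤ 1 := by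
    intro n
    filter_upwards [hX] with x hx
    obtain ⟨w, rfl⟩ := cantorSet_subset_range_foldCode hx
    simp only [u]
    rw [truncPotential_foldCode h hs, add_sub_cancel_left, Real.norm_eq_abs,
      abs_of_nonneg (div_nonneg (orbitSum_nonneg h hs0.le w n) n.cast_nonneg)]
    exact div_le_one_of_le₀ (orbitSum_le h hs0.le w n) n.cast_nonneg
  have hconv := tendsto_integral_of_dominated_convergence (μ := μ) (F := u)
    (f := fun _ => α * Real.log 2) (fun _ => 1)
    (fun n => (((measurable_truncPotential s _).sub_const 1).div_const _).aestronglyMeasurable)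
    (integrable_const _) hbound hlim
  have hconst : Tendsto (fun n => ∫ x, u n x ∂μ) atTop (𝓝 E) := by
    refine tendsto_const_nhds.congr' ?_
    filter_upwards [eventually_gt_atTop 0] with n hn
    have hn0 : (n : ℝ) ≠ 0 := by positivity
    have hi : Integrable (fun x => truncPotential μ s x ((1 / 3) ^ n)) μ :=
      h.integrable (measurable_truncPotential s _)
        fun x _ => abs_truncPotential_le h hs0 (by positivity) x
    simp only [u]
    rw [integral_div, integral_sub hi (integrable_const _), integral_truncPotential_pow h hs]
    simp only [integral_const, probReal_univ, smul_eq_mul, one_mul]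
    field_simp
    ring
  have := tendsto_nhds_unique hconv hconst
  simp only [integral_const, probReal_univ, smul_eq_mul, one_mul] at this
  rw [← this]
  field_simp

end Almost

section Spectrum

variable {μ : Measure ℝ} {s : ℝ}

lemma ae_tendsto_orbitSum (h : FoldInvariant (1 / 2) μ) (hs : 0 ≤ s) (p : unitInterval) :
    ∀ᵐ w ∂codeMeasure p, Tendsto (fun n : ℕ => orbitSum μ s w n / n) atTop
      (𝓝 (∫ x, rieszAvg μ s (1 + x) ∂(codeMeasure p).map foldCode)) := by
  have := h.isProb
  have hmr := measurable_rieszAvg_add (μ := μ) 1 s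
  have hshift := measurePreserving_shiftCode p
  let g : (ℕ → Bool) → ℝ := fun w => rieszAvg μ s (1 + foldCode (shiftCode w))
  have hg : Measurable g := hmr.comp (measurable_foldCode.comp hshift.measurable)
  have huc : UniformContinuousOn (fun x => rieszAvg μ s (1 + x)) (Icc 0 1) := by
    refine isCompact_Icc.uniformContinuousOn_of_continuous ?_
    refine ((convexOn_rieszAvg h hs).continuousOn isOpen_Ioi).comp (by fun_prop) fun x hx => ?_
    simp only [mem_Ioi]
    linarith [hx.1]
  have hu : ∀ ε > 0, ∃ m : ℕ, ∀ w w' : ℕ → Bool, (∀ i < m, w i = w' i) → |g w - g w'| ≤ ε := by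
    intro ε hε
    obtain ⟨δ, hδ, H⟩ := Metric.uniformContinuousOn_iff.1 huc ε hε
    obtain ⟨m, hm⟩ := exists_pow_lt_of_lt_one hδ (by norm_num : (1 / 3 : ℝ) < 1)
    refine ⟨m + 1, fun w w' hww => ?_⟩
    refine (H _ (foldCode_mem_Icc _) _ (foldCode_mem_Icc _) ?_).le
    refine lt_of_le_of_lt ?_ hm
    rw [Real.dist_eq]
    exact abs_foldCode_sub_le m _ _ fun i hi => hww (i + 1) (by omega)
  have hint : ∫ w, g w ∂codeMeasure p =
      ∫ x, rieszAvg μ s (1 + x) ∂(codeMeasure p).map foldCode := by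
    rw [integral_map measurable_foldCode.aemeasurable hmr.aestronglyMeasurable]
    conv_rhs => rw [← hshift.map_eq]
    exact (integral_map hshift.measurable.aemeasurable
      (hmr.comp measurable_foldCode).aestronglyMeasurable).symm
  rw [← hint]
  filter_upwards [tendsto_birkhoffAverage_shiftCode p hg
    (fun w => abs_rieszAvg_add_le h hs le_rfl _ (foldCode_mem_Icc _)) hu] with w hw
  refine hw.congr fun n => ?_
  simp only [orbitSum, g, Function.iterate_succ_apply']

lemma integral_bit (p : unitInterval) (f : Bool → ℝ) :
    ∫ w, f (w 0) ∂codeMeasure p = p * f true + (1 - p) * f false := by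
  have hf : Measurable f := measurable_of_finite f
  have e : (codeMeasure p).map (Function.eval 0) = bitMeasure p :=
    (measurePreserving_eval_infinitePi (fun _ : ℕ => bitMeasure p) 0).map_eq
  have e2 : ∫ w, f (w 0) ∂codeMeasure p = ∫ b, f b ∂bitMeasure p := by
    rw [← e, integral_map (measurable_pi_apply 0).aemeasurable hf.aestronglyMeasurable]
  have e3 : ∀ b, (bitMeasure p).real {b} = bitWeight p b := fun b => by
    rw [measureReal_def, bitMeasure_singleton, ENNReal.toReal_ofReal (bitWeight_nonneg p b)]
  rw [e2, integral_fintype (Integrable.of_finite), Fintype.sum_bool, e3, e3]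
  simp [bitWeight]

lemma ae_tendsto_log_bitWeight (p : unitInterval) :
    ∀ᵐ w ∂codeMeasure p, Tendsto
      (fun n : ℕ => (∑ k ∈ Finset.range n, -Real.log (bitWeight p (w k))) / n) atTop
      (𝓝 (-(p * Real.log p + (1 - p) * Real.log (1 - p)))) := by
  let f : Bool → ℝ := fun b => -Real.log (bitWeight p b)
  have hf : Measurable f := measurable_of_finite f
  have hg : Measurable fun w : ℕ → Bool => f (w 0) := hf.comp (measurable_pi_apply 0)
  have hb : ∀ w : ℕ → Bool, |f (w 0)| ≤ |f true| + |f false| := by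
    intro w
    cases w 0
    · linarith [abs_nonneg (f true)]
    · linarith [abs_nonneg (f false)]
  have key := tendsto_birkhoffAverage_shiftCode p hg hb fun ε hε =>
    ⟨1, fun w w' hw => by rw [hw 0 one_pos, sub_self, abs_zero]; exact hε.le⟩
  rw [integral_bit] at key
  filter_upwards [key] with w hw
  convert hw using 2
  · simp only [iterate_shiftCode_apply, add_zero, f]
  · simp only [f, bitWeight, cond_true, cond_false]
    ring

lemma le_dimH_level_set (h : FoldInvariant (1 / 2) μ) (hs : s = Real.log 2 / Real.log 3)
    (p : unitInterval) (hp0 : 0 < (p : ℝ)) (hp1 : (p : ℝ) < 1) {α : ℝ}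
    (hα : α = (∫ x, rieszAvg μ s (1 + x) ∂(codeMeasure p).map foldCode) / Real.log 2) :
    ENNReal.ofReal (-(p * Real.log p + (1 - p) * Real.log (1 - p)) / Real.log 3) ≤
      dimH {x ∈ cantorSet | upperAvg μ s x = α ∧ lowerAvg μ s x = α} := by
  have h3 : 0 < Real.log 3 := Real.log_pos (by norm_num)
  set H := -(p * Real.log p + (1 - p) * Real.log (1 - p))
  have hwpos : ∀ b, 0 < bitWeight p b := by
    intro b
    cases b
    · exact sub_pos.2 hp1
    · exact hp0
  refine le_of_forall_lt fun c hc => ?_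
  obtain ⟨c', hcc, hc'⟩ := exists_between hc
  lift c' to NNReal using hc'.ne_top
  refine hcc.trans_le ?_
  have hd : 0 < (c' : ℝ) := by
    have : (0 : ℝ≥0∞) < c' := (zero_le).trans_lt hcc
    exact_mod_cast this
  have hdH : c' * Real.log 3 < H := by
    rw [← lt_div_iff₀ h3]
    by_contra hcon
    rw [not_lt] at hcon
    have := ENNReal.ofReal_le_ofReal hcon
    rw [ENNReal.ofReal_coe_nnreal] at this
    exact absurd hc' (not_lt.2 this)
  let G : Set (ℕ → Bool) := {w | Tendsto (fun n : ℕ => orbitSum μ s w n / n) atTop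
      (𝓝 (∫ x, rieszAvg μ s (1 + x) ∂(codeMeasure p).map foldCode)) ∧
    Tendsto (fun n : ℕ => (∑ k ∈ Finset.range n, -Real.log (bitWeight p (w k))) / n) atTop (𝓝 H)}
  let E : ℕ → Set (ℕ → Bool) := fun N => {w ∈ G | ∀ n, N ≤ n →
    ∏ k ∈ Finset.range n, bitWeight p (w k) ≤ ((1 / 3 : ℝ) ^ n) ^ (c' : ℝ)}
  have hG : ∀ᵐ w ∂codeMeasure p, w ∈ G := by
    filter_upwards [ae_tendsto_orbitSum h (cantorDim_pos hs).le p, ae_tendsto_log_bitWeight p]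
      with w h1 h2
    exact ⟨h1, h2⟩
  have hsub : G ⊆ ⋃ N, E N := by
    intro w hw
    obtain ⟨N, hN⟩ := eventually_atTop.1
      ((hw.2.eventually_const_lt hdH).and (eventually_gt_atTop 0))
    refine mem_iUnion.2 ⟨N, hw, fun n hn => ?_⟩
    obtain ⟨h1, hn0⟩ := hN n hn
    have hn0' : (0 : ℝ) < n := by exact_mod_cast hn0
    rw [lt_div_iff₀ hn0', Finset.sum_neg_distrib, ← Real.log_prod fun k _ => (hwpos _).ne'] at h1
    rw [← Real.log_le_log_iff (Finset.prod_pos fun k _ => hwpos _) (by positivity),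
      Real.log_rpow (by positivity), Real.log_pow, one_div, Real.log_inv]
    linarith
  have hN : ∃ N, codeMeasure p (E N) ≠ 0 := by
    by_contra! hcon
    have h0 : codeMeasure p G = 0 := measure_mono_null hsub (measure_iUnion_null hcon)
    have h1 : ∀ᵐ w ∂codeMeasure p, w ∈ Gᶜ := compl_mem_ae_iff.2 h0
    obtain ⟨w, hw, hw'⟩ := (hG.and h1).exists
    exact hw' hw
  obtain ⟨N, hN⟩ := hN
  have hne := hausdorffMeasure_foldCode_image_ne_zero (codeMeasure p) hd (E := E N) (N := N)
    (fun w hw n hn => by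
      rw [codeMeasure_cylinder]
      exact ENNReal.ofReal_le_ofReal (hw.2 n hn)) hN
  refine (le_dimH_of_hausdorffMeasure_ne_zero hne).trans (dimH_mono ?_)
  rintro _ ⟨w, hw, rfl⟩
  have ht := tendsto_avgA h hs hw.1.1
  rw [← hα] at ht
  exact ⟨foldCode_mem_cantorSet w, ht.limsup_eq, ht.liminf_eq⟩

end Spectrum

section Level

variable {μ : Measure ℝ} {s : ℝ}

lemma dimH_level_set_toReal_div_le (hs : s = Real.log 2 / Real.log 3)
    {a α : ℝ} (ha : 0 < a)
    (hle : ∀ x ∈ cantorSet, a ≤ lowerAvg μ s x) :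
    (dimH {x ∈ cantorSet | upperAvg μ s x = α ∧ lowerAvg μ s x = α}).toReal / (s * α) ≤ 1 / a := by
  have hs0 := cantorDim_pos hs
  rcases eq_empty_or_nonempty {x ∈ cantorSet | upperAvg μ s x = α ∧ lowerAvg μ s x = α} with h0 | h0
  · rw [h0, dimH_empty]
    simpa using ha.le
  · obtain ⟨x, hx, -, hxl⟩ := h0
    have haα : a ≤ α := hxl ▸ hle x hx
    have hd : (dimH {x ∈ cantorSet | upperAvg μ s x = α ∧ lowerAvg μ s x = α}).toReal ≤ s :=
      ENNReal.toReal_le_of_le_ofReal hs0.le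
        ((dimH_mono (sep_subset _ _)).trans (dimH_cantorSet_le hs))
    rw [div_le_div_iff₀ (mul_pos hs0 (ha.trans_le haα)) ha]
    nlinarith

end Level

/-- Numerical bounds for the critical quantity `(sup_α f(α)/(sα))^{1/s}` for the natural
measure on the middle-thirds Cantor set, where `f` is the multifractal spectrum of the
average density, `α₀` is its `μ`-a.s. value and `α_min = inf_{x∈X} A̲(x)`. -/
theorem cantor_critical_constant_bounds
    (s : ℝ) (hs : s = Real.log 2 / Real.log 3)
    (μ : Measure ℝ) (hμ : μ = (μH[s] cantorSet)⁻¹ • (μH[s]).restrict cantorSet)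
    (α₀ : ℝ) (hα₀ : ∀ᵐ x ∂μ, upperAvg μ s x = α₀ ∧ lowerAvg μ s x = α₀)
    (αmin : ℝ) (hαmin : αmin = sInf {v : ℝ | ∃ x ∈ cantorSet, v = lowerAvg μ s x})
    (K : ℝ)
    (hK : K = sSup {v : ℝ | ∃ α : ℝ, 0 < α ∧
      v = (dimH {x ∈ cantorSet | upperAvg μ s x = α ∧ lowerAvg μ s x = α}).toReal / (s * α)}) :
    (1 / α₀) ^ (1 / s) < 1.06126 ∧
    (1.06126 : ℝ) ≤ K ^ (1 / s) ∧
    K ^ (1 / s) ≤ (1 / αmin) ^ (1 / s) ∧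
    (1 / αmin) ^ (1 / s) ≤ 1.37546 := by
  have hs0 := cantorDim_pos hs
  have h3 : 0 < Real.log 3 := Real.log_pos (by norm_num)
  have h2 : 0 < Real.log 2 := Real.log_pos (by norm_num)
  have h : FoldInvariant (1 / 2) μ := hμ ▸ foldInvariant_cantor hs
  have hr : μ.map (fun x => 1 - x) = μ := hμ ▸ map_one_sub_cantor s
  have hX : ∀ᵐ x ∂μ, x ∈ cantorSet := by
    rw [hμ]
    exact Measure.ae_smul_measure (ae_restrict_mem isClosed_cantorSet.measurableSet) _
  have hmono : ∀ {a b : ℝ}, 0 ≤ a → a ≤ b ^ s → 0 ≤ b → a ^ (1 / s) ≤ b := by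
    intro a b ha hab hb
    calc a ^ (1 / s) ≤ (b ^ s) ^ (1 / s) := Real.rpow_le_rpow ha hab (by positivity)
      _ = b := by rw [← Real.rpow_mul hb, mul_one_div_cancel hs0.ne', Real.rpow_one]
  -- the almost sure value
  have hα₀E : α₀ = (∫ x, rieszAvg μ s (1 + x) ∂μ) / Real.log 2 := by
    refine eq_integral_rieszAvg_of_tendsto_avgA h hs hX ?_
    filter_upwards [hX, hα₀] with x hx hxα
    exact tendsto_avgA_of_upperAvg_eq_lowerAvg h hs hx hxα.1 hxα.2
  have hα₀lt : (1.06126 : ℝ) ^ (-s) < α₀ := by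
    rw [hα₀E, lt_div_iff₀ h2, mul_comm]
    exact log_two_lt_integral_rieszAvg hs h hr
  -- the minimal value
  have hF2 : (1.37546 : ℝ) ^ (-s) ≤ rieszAvg μ s 2 / Real.log 2 := by
    rw [le_div_iff₀ h2]
    exact log_two_le_rieszAvg_two hs h hr
  have hlow : ∀ x ∈ cantorSet, (1.37546 : ℝ) ^ (-s) ≤ lowerAvg μ s x := fun x hx =>
    hF2.trans (le_lowerAvg h hs hx)
  have hmin : (1.37546 : ℝ) ^ (-s) ≤ αmin := by
    rw [hαmin]
    refine le_csInf ⟨_, 0, zero_mem_cantorSet, rfl⟩ ?_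
    rintro _ ⟨x, hx, rfl⟩
    exact hlow x hx
  have hmin0 : 0 < αmin := lt_of_lt_of_le (by positivity) hmin
  have hmin_le : ∀ x ∈ cantorSet, αmin ≤ lowerAvg μ s x := by
    intro x hx
    rw [hαmin]
    refine csInf_le ⟨(1.37546 : ℝ) ^ (-s), ?_⟩ ⟨x, hx, rfl⟩
    rintro _ ⟨y, hy, rfl⟩
    exact hlow y hy
  have hub : ∀ v ∈ {v : ℝ | ∃ α : ℝ, 0 < α ∧
      v = (dimH {x ∈ cantorSet | upperAvg μ s x = α ∧ lowerAvg μ s x = α}).toReal / (s * α)},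
      v ≤ 1 / αmin := by
    rintro _ ⟨α, -, rfl⟩
    exact dimH_level_set_toReal_div_le hs hmin0 hmin_le
  have hKmin : K ≤ 1 / αmin := by
    rw [hK]
    exact csSup_le ⟨_, 1, one_pos, rfl⟩ hub
  -- a Bernoulli measure gives the lower bound
  have hKlow : (1.06126 : ℝ) ^ s ≤ K := by
    let p : unitInterval := ⟨27 / 50, by norm_num, by norm_num⟩
    have hν : FoldInvariant (27 / 50) ((codeMeasure p).map foldCode) := foldInvariant_map_foldCode p
    have hent := rpow_mul_integral_rieszAvg_le_entropy hs h hr hν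
    set E := ∫ x, rieszAvg μ s (1 + x) ∂(codeMeasure p).map foldCode with hE
    have hE0 : 0 < E := by
      have := hν.isProb
      have hc : ∫ _, rieszAvg μ s 2 ∂(codeMeasure p).map foldCode ≤ E := by
        refine integral_mono_ae (integrable_const _) (integrable_rieszAvg_add h hν hs0.le le_rfl) ?_
        filter_upwards [hν.supp] with x hx
        exact rieszAvg_anti h hs0.le (by linarith [hx.1]) (by linarith [hx.2])
      simp only [integral_const, probReal_univ, smul_eq_mul, one_mul] at hc
      have h0 : 0 < rieszAvg μ s 2 / Real.log 2 := lt_of_lt_of_le (by positivity) hF2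
      exact ((div_pos_iff_of_pos_right h2).1 h0).trans_le hc
    have hdim := le_dimH_level_set h hs p (by norm_num [p]) (by norm_num [p]) (α := E / Real.log 2)
      rfl
    have hfin : dimH {x ∈ cantorSet | upperAvg μ s x = E / Real.log 2 ∧
        lowerAvg μ s x = E / Real.log 2} ≠ ⊤ :=
      ne_top_of_le_ne_top ENNReal.ofReal_ne_top
        ((dimH_mono (sep_subset _ _)).trans (dimH_cantorSet_le hs))
    have hdim' := (ENNReal.ofReal_le_iff_le_toReal hfin).1 hdim
    rw [div_le_iff₀ h3] at hdim'
    have hmem := le_csSup ⟨1 / αmin, hub⟩ ⟨E / Real.log 2, div_pos hE0 h2, rfl⟩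
    rw [← hK] at hmem
    refine le_trans ?_ hmem
    have hsα : s * (E / Real.log 2) = E / Real.log 3 := by
      rw [hs]; field_simp
    rw [hsα, le_div_iff₀ (div_pos hE0 h3), ← mul_div_assoc, div_le_iff₀ h3]
    exact hent.trans hdim'
  have hK0 : 0 < K := lt_of_lt_of_le (by positivity) hKlow
  refine ⟨?_, ?_, Real.rpow_le_rpow hK0.le hKmin (by positivity), ?_⟩
  · have h0 : 0 < α₀ := lt_trans (by positivity) hα₀lt
    have h1 : 1 / α₀ < (1.06126 : ℝ) ^ s := by
      rw [Real.rpow_neg (by norm_num)] at hα₀lt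
      rw [one_div]
      exact inv_lt_of_inv_lt₀ (by positivity) hα₀lt
    calc (1 / α₀) ^ (1 / s) < ((1.06126 : ℝ) ^ s) ^ (1 / s) :=
          Real.rpow_lt_rpow (by positivity) h1 (by positivity)
      _ = 1.06126 := by
          rw [← Real.rpow_mul (by norm_num), mul_one_div_cancel hs0.ne', Real.rpow_one]
  · calc (1.06126 : ℝ) = ((1.06126 : ℝ) ^ s) ^ (1 / s) := by
          rw [← Real.rpow_mul (by norm_num), mul_one_div_cancel hs0.ne', Real.rpow_one]
      _ ≤ K ^ (1 / s) := Real.rpow_le_rpow (by positivity) hKlow (by positivity)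
  · refine hmono (by positivity) ?_ (by norm_num)
    rw [Real.rpow_neg (by norm_num)] at hmin
    rw [one_div]
    exact inv_le_of_inv_le₀ (by positivity) hmin

end
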